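/- Let n ≥ 2, 0 < τ ≤ p < ∞, α > 0, and let μ be a positive Borel measure on ℝ^{n+1}_+. Then the following are equivalent: (i) there is C > 0 with μ(Q_w) ≤ C·s^{n + αp} for every w = (y,s) ∈ ℝ^{n+1}_+; (ii) F_α^{p,τ} is continuously embedded into L^p(ℝ^{n+1}_+, dμ), i.e. there is C' > 0 such that ∫_{ℝ^{n+1}_+} |f(z)|^p dμ(z) ≤ C' ‖f‖_{F_α^{p,τ}}^p for every harmonic f on ℝ^{n+1}_+ with ‖f‖_{F_α^{p,τ}} < ∞. -/

import Mathlib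

open MeasureTheory Real Set
open scoped ENNReal

noncomputable section

abbrev Euc (N : ℕ) : Type := EuclideanSpace ℝ (Fin N)

/-- The point `(x, t) ∈ ℝ^{n+1}`. -/
def pt {n : ℕ} (x : Euc n) (t : ℝ) : Euc (n + 1) :=
  (EuclideanSpace.equiv (Fin (n + 1)) ℝ).symm (Fin.snoc (fun i => x i) t)

/-- horizontal part of a point of ℝ^{n+1} -/
def xp {n : ℕ} (z : Euc (n + 1)) : Euc n :=
  (EuclideanSpace.equiv (Fin n) ℝ).symm (fun i => z i.castSucc)

/-- vertical part of a point of ℝ^{n+1} -/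
def tp {n : ℕ} (z : Euc (n + 1)) : ℝ := z (Fin.last n)

/-- The upper half space ℝ^{n+1}_+. -/
def upperHS (n : ℕ) : Set (Euc (n + 1)) := {z | 0 < tp z}

/-- |z - w̄| where z = (x,t), w̄ = (y, -s): Euclidean distance -/
def dB {n : ℕ} (x : Euc n) (t : ℝ) (y : Euc n) (s : ℝ) : ℝ :=
  dist (pt x t) (pt y (-s))

/-- the measure t^λ dx dt on ℝ^n × (0,∞), identified with ℝ^{n+1}_+ -/
def mLam (n : ℕ) (l : ℝ) : Measure (Euc n × ℝ) :=
  ((volume : Measure (Euc n)).prod ((volume : Measure ℝ).restrict (Ioi 0))).withDensity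
    (fun zt => ENNReal.ofReal (zt.2 ^ l))

/-- second derivative of `f` at `z` along direction `v` -/
def d2 {V : Type*} [NormedAddCommGroup V] [NormedSpace ℝ V] (f : V → ℝ) (z v : V) : ℝ :=
  iteratedFDeriv ℝ 2 f z ![v, v]

/-- `f` is harmonic on a subset of ℝ^N : twice continuously differentiable with
vanishing Laplacian. -/
def HarmonicOnE {N : ℕ} (f : Euc N → ℝ) (s : Set (Euc N)) : Prop :=
  ContDiffOn ℝ 2 f s ∧ ∀ z ∈ s, ∑ i, d2 f z (EuclideanSpace.single i 1) = 0

/-- `f` is harmonic on (ℝ^{n+1}_+)^m, viewed as an open subset of ℝ^{m(n+1)}. -/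
def HarmonicOnM {n m : ℕ} (f : (Fin m → Euc (n + 1)) → ℝ) : Prop :=
  ContDiffOn ℝ 2 f {z | ∀ j, z j ∈ upperHS n} ∧
  ∀ z ∈ {z : Fin m → Euc (n + 1) | ∀ j, z j ∈ upperHS n},
    ∑ j, ∑ i, d2 f z (Function.update (0 : Fin m → Euc (n + 1)) j (EuclideanSpace.single i 1)) = 0

/-- `f` is harmonic in each variable separately on (ℝ^{n+1}_+)^m -/
def HarmonicSep {n m : ℕ} (f : (Fin m → Euc (n + 1)) → ℝ) : Prop :=
  ∀ (j : Fin m) (z : Fin m → Euc (n + 1)), (∀ k, z k ∈ upperHS n) →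
    HarmonicOnE (fun w => f (Function.update z j w)) (upperHS n)

/-- the closed cube centered at (y,s) with side length s -/
def Qcube {n : ℕ} (y : Euc n) (s : ℝ) : Set (Euc (n + 1)) :=
  {z | (∀ i : Fin n, |z (Fin.castSucc i) - y i| ≤ s / 2) ∧ |tp z - s| ≤ s / 2}

/-- the A^p_λ (quasi)-norm, raised to the power p -/
def normAp (n : ℕ) (f : Euc (n + 1) → ℝ) (p l : ℝ) : ℝ≥0∞ :=
  ∫⁻ zt : Euc n × ℝ, ENNReal.ofReal (|f (pt zt.1 zt.2)| ^ p) ∂(mLam n l)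

/-- membership in the harmonic Bergman space A^p_λ -/
def memAp (n : ℕ) (f : Euc (n + 1) → ℝ) (p l : ℝ) : Prop :=
  HarmonicOnE f (upperHS n) ∧ normAp n f p l < ⊤


/-- the Triebel–Lizorkin norm ‖f‖_{F^{p,q}_α} -/
def normF (n : ℕ) (f : Euc (n + 1) → ℝ) (p q α : ℝ) : ℝ≥0∞ :=
  (∫⁻ x : Euc n,
    (∫⁻ t in Ioi (0 : ℝ), ENNReal.ofReal (|f (pt x t)| ^ q * t ^ (α * q - 1))) ^ (p / q))
      ^ (1 / p)

theorem lintegral_comp_smul_of_pos {N : ℕ} {g : Euc N → ℝ≥0∞} (hg : Measurable g) {r : ℝ}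
    (hr : 0 < r) :
    ∫⁻ y, g (r • y) = ENNReal.ofReal ((r ^ N)⁻¹) * ∫⁻ y, g y := by
  have h1 := lintegral_map (μ := (volume : Measure (Euc N))) hg (measurable_const_smul r)
  rw [Measure.map_addHaar_smul volume hr.ne'] at h1
  rw [← h1, lintegral_smul_measure]
  simp [abs_of_pos hr]

theorem hasDerivAt_max_zero_sq (x : ℝ) :
    HasDerivAt (fun x : ℝ => (max x 0) ^ 2) (2 * max x 0) x := by
  rcases lt_trichotomy x 0 with h | h | h
  · rw [max_eq_right h.le, mul_zero]
    refine (hasDerivAt_const x (0 : ℝ)).congr_of_eventuallyEq ?_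
    filter_upwards [gt_mem_nhds h] with y hy
    simp [max_eq_right hy.le]
  · subst h
    simp only [max_self, mul_zero]
    rw [hasDerivAt_iff_isLittleO_nhds_zero]
    simp only [zero_add, max_self, smul_zero, sub_zero]
    have h2 : (fun h : ℝ => h ^ 2) =o[nhds 0] fun h => h := by
      simpa using Asymptotics.isLittleO_pow_id (𝕜 := ℝ) (n := 2) (by norm_num)
    refine Asymptotics.IsBigO.trans_isLittleO (Asymptotics.IsBigO.of_bound 1 ?_) h2
    refine Filter.Eventually.of_forall fun y => ?_
    simp only [norm_pow, norm_eq_abs, one_mul]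
    rcases le_total y 0 with hy | hy
    · simp [max_eq_right hy, sq_nonneg]
    · simp [max_eq_left hy]
  · rw [max_eq_left h.le]
    have := (hasDerivAt_pow 2 x)
    simp only [Nat.cast_ofNat, Nat.add_one_sub_one, pow_one] at this
    refine this.congr_of_eventuallyEq ?_
    filter_upwards [lt_mem_nhds h] with y hy
    simp [max_eq_left hy.le]

/-- A radial bump supported in the closed unit ball. -/
noncomputable def bump {N : ℕ} (y : Euc N) : ℝ := max (1 - ‖y‖ ^ 2) 0

theorem continuous_bump {N : ℕ} : Continuous (bump (N := N)) := by
  unfold bump; fun_prop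

theorem bump_nonneg {N : ℕ} (y : Euc N) : 0 ≤ bump y := le_max_right _ _

theorem bump_le_one {N : ℕ} (y : Euc N) : bump y ≤ 1 := by
  unfold bump
  exact max_le (by nlinarith [sq_nonneg ‖y‖]) zero_le_one

theorem bump_eq_zero {N : ℕ} {y : Euc N} (h : 1 ≤ ‖y‖) : bump y = 0 :=
  max_eq_right (by nlinarith)

theorem hasCompactSupport_bump {N : ℕ} : HasCompactSupport (bump (N := N)) :=
  HasCompactSupport.intro (isCompact_closedBall 0 1) fun y hy =>
    bump_eq_zero (by simpa using (not_le.1 (by simpa using hy)).le)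

theorem integral_bump_pos (N : ℕ) : 0 < ∫ y : Euc N, bump y := by
  refine continuous_bump.integral_pos_of_hasCompactSupport_nonneg_nonzero
    hasCompactSupport_bump bump_nonneg (x := 0) ?_
  simp [bump]

theorem hasFDerivAt_bump_sq {N : ℕ} (y : Euc N) :
    HasFDerivAt (fun y : Euc N => bump y ^ 2) ((-4 * bump y) • innerSL ℝ y) y := by
  have h1 : HasFDerivAt (fun y : Euc N => 1 - ‖y‖ ^ 2) (-(2 • innerSL ℝ y)) y :=
    (hasStrictFDerivAt_norm_sq y).hasFDerivAt.const_sub 1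
  have := (hasDerivAt_max_zero_sq (1 - ‖y‖ ^ 2)).comp_hasFDerivAt y h1
  refine this.congr_fderiv ?_
  ext v
  simp [bump]
  ring

theorem integral_bump_mul_fderiv_eq_zero {N : ℕ} {f : Euc N → ℝ} (hf : ContDiff ℝ 2 f)
    {z : Euc N} {r s : ℝ} (hs : 0 ≤ s) (hsr : s < r)
    (hl : ∀ w ∈ Metric.ball z r,
      ∑ i, fderiv ℝ (fderiv ℝ f) w (EuclideanSpace.single i 1) (EuclideanSpace.single i 1) = 0) :
    ∫ y, bump y * fderiv ℝ f (z + s • y) y = 0 := by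
  have hf1 : ContDiff ℝ 1 (fderiv ℝ f) := hf.fderiv_right (by norm_num)
  have hf2 : Continuous (fderiv ℝ (fderiv ℝ f)) := hf1.continuous_fderiv (by norm_num)
  have hf0 : Continuous (fderiv ℝ f) := hf1.continuous
  have hcs : HasCompactSupport (fun y : Euc N => bump y ^ 2) :=
    hasCompactSupport_bump.comp_left (g := fun x => x ^ 2) (by simp)
  have key : ∀ i : Fin N, ∫ y, bump y ^ 2 * (s * fderiv ℝ (fderiv ℝ f) (z + s • y)
      (EuclideanSpace.single i 1) (EuclideanSpace.single i 1)) =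
      4 * ∫ y, bump y * (y i * fderiv ℝ f (z + s • y) (EuclideanSpace.single i 1)) := by
    intro i
    have hg : ∀ y : Euc N, HasFDerivAt
        (fun y => fderiv ℝ f (z + s • y) (EuclideanSpace.single i (1:ℝ)))
        (s • (fderiv ℝ (fderiv ℝ f) (z + s • y)).flip (EuclideanSpace.single i 1)) y := by
      intro y
      have h1 : HasFDerivAt (fderiv ℝ f) (fderiv ℝ (fderiv ℝ f) (z + s • y)) (z + s • y) :=
        (hf1.differentiable (by norm_num) _).hasFDerivAt
      have h2 : HasFDerivAt (fun y : Euc N => z + s • y)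
          (s • ContinuousLinearMap.id ℝ (Euc N)) y :=
        ((hasFDerivAt_id y).const_smul s).const_add z
      have h3 := (h1.comp y h2).clm_apply (hasFDerivAt_const (EuclideanSpace.single i (1:ℝ)) y)
      refine h3.congr_fderiv ?_
      ext v
      simp
    have := integral_bilinear_hasFDerivAt_right_eq_neg_left_of_integrable
      (μ := (volume : Measure (Euc N))) (B := ContinuousLinearMap.mul ℝ ℝ)
      (f := fun y : Euc N => bump y ^ 2) (f' := fun y => (-4 * bump y) • innerSL ℝ y)
      (g := fun y => fderiv ℝ f (z + s • y) (EuclideanSpace.single i (1:ℝ)))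
      (g' := fun y => s • (fderiv ℝ (fderiv ℝ f) (z + s • y)).flip (EuclideanSpace.single i 1))
      (v := EuclideanSpace.single i 1) ?_ ?_ ?_ (fun y _ => hasFDerivAt_bump_sq y)
      (fun y _ => hg y)
    · simp only [ContinuousLinearMap.mul_apply', _root_.smul_apply,
        ContinuousLinearMap.flip_apply, smul_eq_mul, innerSL_apply_apply] at this
      rw [this, ← integral_neg, ← integral_const_mul]
      congr 1
      ext y
      simp [EuclideanSpace.inner_single_right]
      ring
    all_goals
      refine Continuous.integrable_of_hasCompactSupport ?_ ?_
    · simp only [ContinuousLinearMap.mul_apply', _root_.smul_apply,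
        smul_eq_mul, innerSL_apply_apply]
      have := continuous_bump (N := N)
      fun_prop
    · refine (hasCompactSupport_bump (N := N)).mono fun y hy => ?_
      contrapose! hy
      simp only [Function.mem_support, not_not] at hy ⊢
      simp [hy]
    · simp only [ContinuousLinearMap.mul_apply', _root_.smul_apply,
        smul_eq_mul, ContinuousLinearMap.flip_apply]
      have := continuous_bump (N := N)
      fun_prop
    · refine (hasCompactSupport_bump (N := N)).mono fun y hy => ?_
      contrapose! hy
      simp only [Function.mem_support, not_not] at hy ⊢
      simp [hy]
    · simp only [ContinuousLinearMap.mul_apply']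
      have := continuous_bump (N := N)
      fun_prop
    · refine (hasCompactSupport_bump (N := N)).mono fun y hy => ?_
      contrapose! hy
      simp only [Function.mem_support, not_not] at hy ⊢
      simp [hy]
  have hcb := continuous_bump (N := N)
  have e1 : ∀ y : Euc N, bump y * fderiv ℝ f (z + s • y) y =
      ∑ i, bump y * (y i * fderiv ℝ f (z + s • y) (EuclideanSpace.single i 1)) := by
    intro y
    rw [← Finset.mul_sum]
    congr 1
    conv_lhs => rw [show y = ∑ i, y i • EuclideanSpace.single i (1:ℝ) by
      simpa using ((EuclideanSpace.basisFun (Fin N) ℝ).sum_repr y).symm]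
    rw [map_sum]
    conv_lhs => rw [← show y = ∑ i, y i • EuclideanSpace.single i (1:ℝ) by
      simpa using ((EuclideanSpace.basisFun (Fin N) ℝ).sum_repr y).symm]
    simp
  have e2 : ∑ i : Fin N, ∫ y, bump y ^ 2 * (s * fderiv ℝ (fderiv ℝ f) (z + s • y)
      (EuclideanSpace.single i 1) (EuclideanSpace.single i 1)) = 0 := by
    rw [← integral_finsetSum]
    · rw [← integral_zero (Euc N) ℝ (μ := volume)]
      congr 1
      ext y
      rw [← Finset.mul_sum, ← Finset.mul_sum]
      by_cases hy : 1 ≤ ‖y‖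
      · simp [bump_eq_zero hy]
      · rw [hl, mul_zero, mul_zero]
        simp only [Metric.mem_ball, dist_self_add_left, norm_smul, norm_eq_abs, abs_of_nonneg hs]
        push Not at hy
        nlinarith [norm_nonneg y]
    · intro i _
      refine Continuous.integrable_of_hasCompactSupport (by fun_prop) ?_
      refine (hasCompactSupport_bump (N := N)).mono fun y hy => ?_
      contrapose! hy
      simp only [Function.mem_support, not_not] at hy ⊢
      simp [hy]
  simp_rw [e1]
  rw [integral_finsetSum]
  · simp_rw [key, ← Finset.mul_sum] at e2
    linarith
  · intro i _
    refine Continuous.integrable_of_hasCompactSupport (by fun_prop) ?_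
    refine (hasCompactSupport_bump (N := N)).mono fun y hy => ?_
    contrapose! hy
    simp only [Function.mem_support, not_not] at hy ⊢
    simp [hy]

/-- Weighted mean value property. -/
theorem integral_bump_mul_eq {N : ℕ} {f : Euc N → ℝ} (hf : ContDiff ℝ 2 f)
    {z : Euc N} {r : ℝ} (hr : 0 < r)
    (hl : ∀ w ∈ Metric.ball z r,
      ∑ i, fderiv ℝ (fderiv ℝ f) w (EuclideanSpace.single i 1) (EuclideanSpace.single i 1) = 0) :
    ∫ y, bump y * f (z + r • y) = f z * ∫ y : Euc N, bump y := by
  have hcb := continuous_bump (N := N)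
  have hf0 : Continuous (fderiv ℝ f) := hf.continuous_fderiv (by norm_num)
  have hfc : Continuous f := hf.continuous
  have hd : ∀ s₀ : ℝ, HasDerivAt (fun s : ℝ => ∫ y, bump y * f (z + s • y))
      (∫ y, bump y * fderiv ℝ f (z + s₀ • y) y) s₀ := by
    intro s₀
    have hcont : Continuous (fun q : ℝ × Euc N => fderiv ℝ f (z + q.1 • q.2) q.2) := by fun_prop
    obtain ⟨M, hM⟩ := ((isCompact_closedBall s₀ 1).prod
      (isCompact_closedBall (0 : Euc N) 1)).exists_bound_of_continuousOn hcont.continuousOn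
    refine (hasDerivAt_integral_of_dominated_loc_of_deriv_le (𝕜 := ℝ)
      (F := fun (s : ℝ) (y : Euc N) => bump y * f (z + s • y))
      (F' := fun (s : ℝ) (y : Euc N) => bump y * fderiv ℝ f (z + s • y) y)
      (s := Metric.ball s₀ 1) (bound := fun y => bump y * M) (Metric.ball_mem_nhds _ one_pos)
      ?_ ?_ ?_ ?_ ?_ ?_).2
    · exact Filter.Eventually.of_forall fun s => Continuous.aestronglyMeasurable (by fun_prop)
    · refine Continuous.integrable_of_hasCompactSupport (by fun_prop) ?_
      exact hasCompactSupport_bump.mul_right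
    · exact Continuous.aestronglyMeasurable (by fun_prop)
    · refine Filter.Eventually.of_forall fun y s hs => ?_
      rw [norm_mul, norm_eq_abs, abs_of_nonneg (bump_nonneg y)]
      by_cases hy : 1 ≤ ‖y‖
      · simp [bump_eq_zero hy]
      · refine mul_le_mul_of_nonneg_left (hM (s, y) ⟨Metric.ball_subset_closedBall hs, ?_⟩)
          (bump_nonneg y)
        simpa using (not_le.1 hy).le
    · refine Continuous.integrable_of_hasCompactSupport (by fun_prop) ?_
      exact hasCompactSupport_bump.mul_right
    · refine Filter.Eventually.of_forall fun y s _ => ?_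
      have h2 : HasDerivAt (fun s : ℝ => z + s • y) y s := by
        simpa using ((hasDerivAt_id s).smul_const y).const_add z
      exact (((hf.differentiable (by norm_num) _).hasFDerivAt.comp_hasDerivAt s h2)).const_mul _
  have := constant_of_has_deriv_right_zero (f := fun s : ℝ => ∫ y, bump y * f (z + s • y))
    (a := 0) (b := r) (fun s _ => (hd s).continuousAt.continuousWithinAt) (fun s hs => by
      have := (hd s).hasDerivWithinAt (s := Ici s)
      rwa [integral_bump_mul_fderiv_eq_zero hf hs.1 hs.2 hl] at this) r ⟨hr.le, le_rfl⟩
  simp only [zero_smul, add_zero] at this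
  rw [this, integral_mul_const, mul_comm]

theorem d2_eq_fderiv_fderiv {N : ℕ} (f : Euc N → ℝ) (z v : Euc N) :
    d2 f z v = fderiv ℝ (fderiv ℝ f) z v v := by
  simp [d2, iteratedFDeriv_two_apply]

theorem ofReal_abs_le_lintegral_ball {N : ℕ} {f : Euc N → ℝ} {U : Set (Euc N)}
    (hU : IsOpen U) (hf : HarmonicOnE f U) {z : Euc N} {r : ℝ} (hr : 0 < r)
    (hz : Metric.closedBall z (2 * r) ⊆ U) :
    ENNReal.ofReal |f z| ≤ ENNReal.ofReal ((∫ y : Euc N, bump y)⁻¹ * (r ^ N)⁻¹) *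
      ∫⁻ w in Metric.ball z r, ENNReal.ofReal |f w| := by
  let χ : ContDiffBump z := ⟨r, 2 * r, hr, by linarith⟩
  let g : Euc N → ℝ := fun w => χ w * f w
  have hg : ContDiff ℝ 2 g := by
    refine contDiff_iff_contDiffAt.2 fun w => ?_
    by_cases hw : w ∈ tsupport g
    swap
    · exact contDiffAt_const.congr_of_eventuallyEq (notMem_tsupport_iff_eventuallyEq.1 hw)
    have hw' : w ∈ U := by
      refine hz ?_
      have := tsupport_mul_subset_left hw
      rwa [χ.tsupport_eq] at this
    exact χ.contDiff.contDiffAt.mul ((hf.1 w hw').contDiffAt (hU.mem_nhds hw'))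
  have hgf : ∀ w ∈ Metric.ball z r, g =ᶠ[nhds w] f := by
    intro w hw
    filter_upwards [Metric.isOpen_ball.mem_nhds hw] with v hv
    simp [g, χ.one_of_mem_closedBall (Metric.ball_subset_closedBall hv)]
  have hl : ∀ w ∈ Metric.ball z r, ∑ i, fderiv ℝ (fderiv ℝ g) w (EuclideanSpace.single i 1)
      (EuclideanSpace.single i 1) = 0 := by
    intro w hw
    have h1 := ((hgf w hw).fderiv (𝕜 := ℝ)).fderiv (𝕜 := ℝ) |>.eq_of_nhds
    rw [h1]
    simp_rw [← d2_eq_fderiv_fderiv]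
    exact hf.2 w (hz (Metric.ball_subset_closedBall (Metric.ball_subset_ball (by linarith) hw)))
  have hc := integral_bump_pos N
  have hm := integral_bump_mul_eq hg hr hl
  have hgz : g z = f z := (hgf z (Metric.mem_ball_self hr)).eq_of_nhds
  have e1 : |f z| = (∫ y : Euc N, bump y)⁻¹ * |∫ y, bump y * g (z + r • y)| := by
    rw [hm, hgz, abs_mul, abs_of_pos hc]
    field_simp
  have hmeas : Measurable
      (fun w => (Metric.ball z r).indicator (fun w => ENNReal.ofReal |g w|) w) :=
    (ENNReal.measurable_ofReal.comp hg.continuous.abs.measurable).indicator measurableSet_ball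
  have e2 : ENNReal.ofReal |∫ y, bump y * g (z + r • y)| ≤
      ∫⁻ y : Euc N, (Metric.ball z r).indicator (fun w => ENNReal.ofReal |g w|) (z + r • y) := by
    rw [← norm_eq_abs, ofReal_norm]
    refine (enorm_integral_le_lintegral_enorm _).trans (lintegral_mono fun y => ?_)
    by_cases hy : 1 ≤ ‖y‖
    · simp [bump_eq_zero hy]
    · rw [indicator_of_mem, ← ofReal_norm]
      · refine ENNReal.ofReal_le_ofReal ?_
        rw [norm_mul, norm_eq_abs, abs_of_nonneg (bump_nonneg y), norm_eq_abs]
        exact mul_le_of_le_one_left (abs_nonneg _) (bump_le_one y)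
      · simp only [Metric.mem_ball, dist_self_add_left, norm_smul, norm_eq_abs, abs_of_pos hr]
        push Not at hy
        nlinarith [norm_nonneg y]
  have e3 : ∫⁻ y : Euc N,
      (Metric.ball z r).indicator (fun w => ENNReal.ofReal |g w|) (z + r • y) =
      ENNReal.ofReal ((r ^ N)⁻¹) * ∫⁻ w in Metric.ball z r, ENNReal.ofReal |f w| := by
    rw [lintegral_comp_smul_of_pos (N := N)
      (g := fun y => (Metric.ball z r).indicator (fun w => ENNReal.ofReal |g w|) (z + y))
      (hmeas.comp (measurable_const_add z)) hr,
      lintegral_add_left_eq_self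
        (fun y => (Metric.ball z r).indicator (fun w => ENNReal.ofReal |g w|) y),
      lintegral_indicator measurableSet_ball]
    congr 1
    refine setLIntegral_congr_fun measurableSet_ball fun w hw => ?_
    simp only [(hgf w hw).eq_of_nhds]
  rw [e1, ENNReal.ofReal_mul (by positivity), ENNReal.ofReal_mul (by positivity), mul_assoc,
    ← e3]
  gcongr

/-- Jensen's inequality for powers, without normalisation. -/
theorem lintegral_rpow_le_measure_mul {α : Type*} [MeasurableSpace α] {ν : Measure α} {q : ℝ}
    (hq : 1 ≤ q) {g : α → ℝ≥0∞} (hg : AEMeasurable g ν) :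
    (∫⁻ x, g x ∂ν) ^ q ≤ ν univ ^ (q - 1) * ∫⁻ x, g x ^ q ∂ν := by
  rcases hq.eq_or_lt with rfl | hq
  · simp
  have h := ENNReal.lintegral_mul_le_Lp_mul_Lq ν (Real.HolderConjugate.conjExponent hq) hg
    (aemeasurable_const (b := (1 : ℝ≥0∞)))
  simp only [Pi.mul_apply, mul_one, ENNReal.one_rpow, lintegral_const, one_mul] at h
  calc (∫⁻ x, g x ∂ν) ^ q
      ≤ ((∫⁻ x, g x ^ q ∂ν) ^ (1 / q) * ν univ ^ (1 / q.conjExponent)) ^ q := by gcongr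
    _ = _ := by
      rw [ENNReal.mul_rpow_of_nonneg _ _ (by linarith), ← ENNReal.rpow_mul, ← ENNReal.rpow_mul,
        mul_comm]
      have : q ≠ 0 := by linarith
      have h2 : q - 1 ≠ 0 := by linarith
      congr 2
      · unfold Real.conjExponent
        field_simp
      · field_simp
        simp

/-- Powers of harmonic functions satisfy a sub-mean value property. -/
theorem exists_rpow_le_lintegral_ball {N : ℕ} (hN : 0 < N) {τ : ℝ} (hτ : 0 < τ) :
    ∃ K : ℝ, 0 < K ∧ ∀ (f : Euc N → ℝ) (U : Set (Euc N)), IsOpen U → HarmonicOnE f U →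
      ∀ (z : Euc N) (R : ℝ), 0 < R → Metric.closedBall z R ⊆ U →
      ENNReal.ofReal (|f z| ^ τ) ≤ ENNReal.ofReal (K * (R ^ N)⁻¹) *
        ∫⁻ w in Metric.ball z R, ENNReal.ofReal (|f w| ^ τ) := by
  have hc := inv_pos.2 (integral_bump_pos N)
  set c : ℝ := (∫ y : Euc N, bump y)⁻¹
  rcases le_or_gt τ 1 with h1 | h1
  · set B : ℝ := 2 ^ ((N : ℝ) / τ)
    have hB : 0 < B := by positivity
    refine ⟨c * 2 ^ N * B ^ (1 - τ), by positivity, fun f U hU hf z R hR hz => ?_⟩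
    rcases eq_or_ne (f z) 0 with h0 | h0
    · simp [h0, zero_rpow hτ.ne']
    have hNτ : 0 < (N : ℝ) / τ := by positivity
    have hcont : ContinuousOn (fun w => (R - dist w z) ^ ((N : ℝ) / τ) * |f w|)
        (Metric.closedBall z R) := by
      refine ContinuousOn.mul ?_ (hf.1.continuousOn.mono hz).abs
      exact ContinuousOn.rpow_const (by fun_prop) fun _ _ => Or.inr hNτ.le
    obtain ⟨w, hw, hmax⟩ := (isCompact_closedBall z R).exists_isMaxOn
      ⟨z, Metric.mem_closedBall_self hR.le⟩ hcont
    have hmax' : ∀ v, dist v z ≤ R → (R - dist v z) ^ ((N : ℝ) / τ) * |f v| ≤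
        (R - dist w z) ^ ((N : ℝ) / τ) * |f w| := fun v hv => hmax (by simpa using hv)
    have hwR : dist w z ≤ R := by simpa using hw
    set d := R - dist w z with hd
    set a := |f w| with ha
    have hzm := hmax' z (by simpa using hR.le)
    simp only [dist_self, sub_zero] at hzm
    have hpos : 0 < d ^ ((N : ℝ) / τ) * a :=
      lt_of_lt_of_le (mul_pos (by positivity) (abs_pos.2 h0)) hzm
    have hd0 : 0 < d := by
      rcases (sub_nonneg.2 hwR).eq_or_lt with h | h
      · rw [hd, ← h, zero_rpow hNτ.ne', zero_mul] at hpos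
        exact absurd hpos (lt_irrefl 0)
      · exact h
    have ha0 : 0 < a := pos_of_mul_pos_right hpos (by positivity)
    have hbd : ∀ v ∈ Metric.ball w (d / 2), |f v| ≤ B * a := by
      intro v hv
      have hv1 : dist v w < d / 2 := by simpa using hv
      have hv2 : dist v z ≤ dist v w + dist w z := dist_triangle _ _ _
      have hv3 : d / 2 ≤ R - dist v z := by linarith
      have h4 := hmax' v (by linarith)
      have h5 : (d / 2) ^ ((N : ℝ) / τ) * |f v| ≤ d ^ ((N : ℝ) / τ) * a :=
        le_trans (by gcongr) h4
      rw [div_rpow hd0.le (by norm_num), div_mul_eq_mul_div, div_le_iff₀ (by positivity)] at h5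
      have h6 : 0 < d ^ ((N : ℝ) / τ) := by positivity
      refine le_of_mul_le_mul_left (h5.trans_eq ?_) h6
      ring
    have hsub : Metric.closedBall w (2 * (d / 2)) ⊆ U := by
      refine (Metric.closedBall_subset_closedBall' ?_).trans hz
      linarith
    have hmv := ofReal_abs_le_lintegral_ball hU hf (half_pos hd0) hsub
    have hbound : ∫⁻ v in Metric.ball w (d / 2), ENNReal.ofReal |f v| ≤
        ENNReal.ofReal ((B * a) ^ (1 - τ)) *
          ∫⁻ v in Metric.ball z R, ENNReal.ofReal (|f v| ^ τ) := by
      rw [← lintegral_const_mul' _ _ ENNReal.ofReal_ne_top]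
      refine (setLIntegral_mono' measurableSet_ball fun v hv => ?_).trans
        (lintegral_mono_set (Metric.ball_subset_ball' ?_))
      · rw [← ENNReal.ofReal_mul (by positivity)]
        refine ENNReal.ofReal_le_ofReal ?_
        rcases eq_or_lt_of_le (abs_nonneg (f v)) with h | h
        · rw [← h]; positivity
        · calc |f v| = |f v| ^ (1 - τ) * |f v| ^ τ := by
                rw [← rpow_add h]; simp
            _ ≤ _ := by
                have := rpow_le_rpow h.le (hbd v hv) (by linarith : 0 ≤ 1 - τ)
                gcongr
      · linarith
    have hfz : |f z| ^ τ ≤ (R ^ N)⁻¹ * d ^ N * a ^ τ := by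
      have := rpow_le_rpow (by positivity) hzm hτ.le
      rw [mul_rpow (by positivity) (by positivity), mul_rpow (by positivity) (by positivity),
        ← rpow_mul hR.le, ← rpow_mul hd0.le, div_mul_cancel₀ _ hτ.ne', rpow_natCast,
        rpow_natCast] at this
      rw [mul_assoc, inv_mul_eq_div, le_div_iff₀ (by positivity)]
      linarith
    calc ENNReal.ofReal (|f z| ^ τ)
        ≤ ENNReal.ofReal ((R ^ N)⁻¹ * d ^ N * a ^ τ) := ENNReal.ofReal_le_ofReal hfz
      _ = ENNReal.ofReal ((R ^ N)⁻¹ * d ^ N * a ^ (τ - 1)) * ENNReal.ofReal a := by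
          rw [← ENNReal.ofReal_mul (by positivity), mul_assoc, mul_assoc, mul_assoc,
            rpow_sub_one ha0.ne', div_mul_cancel₀ _ ha0.ne']
      _ ≤ ENNReal.ofReal ((R ^ N)⁻¹ * d ^ N * a ^ (τ - 1)) *
          (ENNReal.ofReal (c * ((d / 2) ^ N)⁻¹) * (ENNReal.ofReal ((B * a) ^ (1 - τ)) *
          ∫⁻ v in Metric.ball z R, ENNReal.ofReal (|f v| ^ τ))) := by
          gcongr
          exact hmv.trans (by gcongr)
      _ = _ := by
          rw [← mul_assoc, ← mul_assoc, ← ENNReal.ofReal_mul (by positivity),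
            ← ENNReal.ofReal_mul (by positivity)]
          congr 2
          rw [mul_rpow hB.le ha0.le, div_pow]
          have : a ^ (1 - τ) = (a ^ (τ - 1))⁻¹ := by rw [← rpow_neg ha0.le]; ring_nf
          rw [this]
          have : a ^ (τ - 1) ≠ 0 := by positivity
          field_simp
  · set v : ℝ := (volume (Metric.ball (0 : Euc N) 1)).toReal
    have hv : 0 < v := ENNReal.toReal_pos (Metric.measure_ball_pos _ _ one_pos).ne'
      measure_ball_lt_top.ne
    refine ⟨c ^ τ * v ^ (τ - 1) * 2 ^ N, by positivity, fun f U hU hf z R hR hz => ?_⟩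
    have hR2 : 0 < R / 2 := half_pos hR
    have hmv := ofReal_abs_le_lintegral_ball hU hf (z := z) hR2
      (by rwa [mul_div_cancel₀ _ two_ne_zero])
    have hbz : Metric.ball z (R / 2) ⊆ U :=
      (Metric.ball_subset_ball (by linarith)).trans (Metric.ball_subset_closedBall.trans hz)
    have hme : AEMeasurable (fun w => ENNReal.ofReal |f w|)
        (volume.restrict (Metric.ball z (R / 2))) :=
      ENNReal.measurable_ofReal.comp_aemeasurable
        ((hf.1.continuousOn.mono hbz).abs.aemeasurable measurableSet_ball)
    have hj := lintegral_rpow_le_measure_mul h1.le hme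
    have hvol : volume (Metric.ball z (R / 2)) = ENNReal.ofReal ((R / 2) ^ N * v) := by
      rw [Measure.addHaar_ball_of_pos volume z hR2, ENNReal.ofReal_mul (by positivity),
        ENNReal.ofReal_toReal measure_ball_lt_top.ne]
      simp
    simp only [Measure.restrict_apply_univ, hvol] at hj
    calc ENNReal.ofReal (|f z| ^ τ) = ENNReal.ofReal |f z| ^ τ := by
          rw [ENNReal.ofReal_rpow_of_nonneg (abs_nonneg _) hτ.le]
      _ ≤ (ENNReal.ofReal (c * ((R / 2) ^ N)⁻¹) *
          ∫⁻ w in Metric.ball z (R / 2), ENNReal.ofReal |f w|) ^ τ := by gcongr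
      _ ≤ ENNReal.ofReal (c * ((R / 2) ^ N)⁻¹) ^ τ *
          (ENNReal.ofReal ((R / 2) ^ N * v) ^ (τ - 1) *
          ∫⁻ w in Metric.ball z (R / 2), ENNReal.ofReal |f w| ^ τ) := by
          rw [ENNReal.mul_rpow_of_nonneg _ _ hτ.le]
          gcongr
      _ = ENNReal.ofReal (c ^ τ * v ^ (τ - 1) * 2 ^ N * (R ^ N)⁻¹) *
          ∫⁻ w in Metric.ball z (R / 2), ENNReal.ofReal (|f w| ^ τ) := by
          simp_rw [ENNReal.ofReal_rpow_of_nonneg (abs_nonneg _) hτ.le]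
          rw [ENNReal.ofReal_rpow_of_nonneg (by positivity) hτ.le,
            ENNReal.ofReal_rpow_of_nonneg (by positivity) (by linarith), ← mul_assoc,
            ← ENNReal.ofReal_mul (by positivity)]
          congr 2
          have hρ : 0 < (R / 2) ^ N := by positivity
          have h2 : 2 ^ N * (R ^ N)⁻¹ = ((R / 2) ^ N)⁻¹ := by
            rw [div_pow]
            field_simp
          rw [mul_assoc _ (2 ^ N), h2, mul_rpow hc.le (by positivity), mul_rpow hρ.le hv.le,
            inv_rpow hρ.le, rpow_sub_one hρ.ne']
          have : ((R / 2) ^ N) ^ τ ≠ 0 := by positivity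
          generalize (R / 2) ^ N = ρ at *
          field_simp
      _ ≤ _ := by
          gcongr
          linarith

section HalfSpace

variable {n : ℕ}

@[simp] theorem pt_castSucc (x : Euc n) (t : ℝ) (i : Fin n) : pt x t i.castSucc = x i := by
  simp [pt]

@[simp] theorem pt_last (x : Euc n) (t : ℝ) : pt x t (Fin.last n) = t := by
  simp [pt]

@[simp] theorem xp_apply (z : Euc (n + 1)) (i : Fin n) : xp z i = z i.castSucc := by
  simp [xp]

@[simp] theorem xp_pt (x : Euc n) (t : ℝ) : xp (pt x t) = x := by
  ext i; simp

@[simp] theorem tp_pt (x : Euc n) (t : ℝ) : tp (pt x t) = t := by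
  simp [tp]

theorem norm_sq_eq_xp_tp (z : Euc (n + 1)) : ‖z‖ ^ 2 = ‖xp z‖ ^ 2 + tp z ^ 2 := by
  simp [EuclideanSpace.norm_sq_eq, Fin.sum_univ_castSucc, tp]

theorem xp_sub (z w : Euc (n + 1)) : xp (z - w) = xp z - xp w := by
  ext i; simp

theorem tp_sub (z w : Euc (n + 1)) : tp (z - w) = tp z - tp w := by
  simp [tp]

theorem dist_xp_le (z w : Euc (n + 1)) : dist (xp z) (xp w) ≤ dist z w := by
  rw [dist_eq_norm, dist_eq_norm, ← xp_sub]
  refine le_of_sq_le_sq ?_ (norm_nonneg _)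
  rw [norm_sq_eq_xp_tp (z - w)]
  nlinarith [sq_nonneg (tp (z - w))]

theorem abs_tp_sub_le (z w : Euc (n + 1)) : |tp z - tp w| ≤ dist z w := by
  rw [dist_eq_norm, ← tp_sub]
  refine abs_le_of_sq_le_sq ?_ (norm_nonneg _)
  rw [norm_sq_eq_xp_tp (z - w)]
  nlinarith [sq_nonneg ‖xp (z - w)‖]

theorem continuous_tp : Continuous (tp (n := n)) := by
  unfold tp; fun_prop

theorem continuous_xp : Continuous (xp (n := n)) := by
  unfold xp; fun_prop

theorem continuous_pt : Continuous (fun q : Euc n × ℝ => pt q.1 q.2) := by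
  unfold pt
  refine (EuclideanSpace.equiv (Fin (n + 1)) ℝ).symm.continuous.comp ?_
  refine continuous_pi fun i => ?_
  refine Fin.lastCases ?_ (fun i => ?_) i
  · simpa using continuous_snd
  · simp only [Fin.snoc_castSucc]; fun_prop

theorem isOpen_upperHS : IsOpen (upperHS n) := isOpen_lt continuous_const continuous_tp

theorem measurePreserving_pt :
    MeasurePreserving (fun q : Euc n × ℝ => pt q.1 q.2) (volume.prod volume) volume := by
  have h1 := PiLp.volume_preserving_toLp (Fin (n + 1))
  have h2 := (volume_preserving_piFinSuccAbove (fun _ : Fin (n + 1) => ℝ) (Fin.last n)).symm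
  have h3 : MeasurePreserving (Prod.swap : (Fin n → ℝ) × ℝ → ℝ × (Fin n → ℝ)) _ _ :=
    Measure.measurePreserving_swap (μ := volume) (ν := volume)
  have h4 := (PiLp.volume_preserving_ofLp (Fin n)).prod (MeasurePreserving.id (volume : Measure ℝ))
  have h5 := h1.comp (h2.comp (h3.comp h4))
  have e : (fun q : Euc n × ℝ => pt q.1 q.2) = WithLp.toLp 2 ∘
      (MeasurableEquiv.piFinSuccAbove (fun _ : Fin (n + 1) => ℝ) (Fin.last n)).symm ∘
      Prod.swap ∘ Prod.map WithLp.ofLp id := by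
    funext q
    ext i
    simp [pt, Fin.insertNthEquiv]
  rw [e]
  exact h5

theorem lintegral_eq_lintegral_pt {h : Euc (n + 1) → ℝ≥0∞} (hh : Measurable h) :
    ∫⁻ w, h w = ∫⁻ y, ∫⁻ u, h (pt y u) := by
  rw [← measurePreserving_pt.lintegral_comp hh]
  exact lintegral_prod _ (hh.comp continuous_pt.measurable).aemeasurable

/-- The truncation of the inner integral of the Triebel–Lizorkin norm to heights comparable
to `ρ`. -/
noncomputable def bandIntegral (g : Euc (n + 1) → ℝ≥0∞) (β ρ : ℝ) (y : Euc n) : ℝ≥0∞ :=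
  ∫⁻ u in Ioc (ρ / 2) (4 * ρ), g (pt y u) * ENNReal.ofReal (u ^ (β - 1))

theorem measurable_bandIntegral {g : Euc (n + 1) → ℝ≥0∞} (hg : Measurable g) (β ρ : ℝ) :
    Measurable (bandIntegral g β ρ) := by
  refine Measurable.lintegral_prod_right' (f := fun q : Euc n × ℝ =>
    g (pt q.1 q.2) * ENNReal.ofReal (q.2 ^ (β - 1))) ?_
  exact (hg.comp continuous_pt.measurable).mul
    (ENNReal.measurable_ofReal.comp (measurable_snd.pow_const _))

theorem one_le_mul_rpow {ρ u : ℝ} (hρ : 0 < ρ) (hu : u ∈ Ioc (ρ / 2) (4 * ρ)) (γ : ℝ) :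
    1 ≤ 4 ^ |γ| * ρ ^ (-γ) * u ^ γ := by
  have hu0 : 0 < u := by linarith [hu.1]
  have e : 4 ^ |γ| * ρ ^ (-γ) * u ^ γ = 4 ^ |γ| * (u / ρ) ^ γ := by
    rw [div_rpow hu0.le hρ.le, rpow_neg hρ.le]; ring
  rw [e]
  have h1 : 1 / 4 ≤ u / ρ := by rw [le_div_iff₀ hρ]; linarith [hu.1]
  have h2 : u / ρ ≤ 4 := by rw [div_le_iff₀ hρ]; exact hu.2
  rcases le_total 0 γ with h | h
  · rw [abs_of_nonneg h, ← mul_rpow (by norm_num) (by positivity)]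
    exact one_le_rpow (by linarith) h
  · have := rpow_le_rpow_of_nonpos (by positivity) h2 h
    calc (1 : ℝ) = 4 ^ |γ| * 4 ^ γ := by
          rw [← rpow_add (by norm_num), abs_of_nonpos h]; simp
      _ ≤ _ := by gcongr

theorem le_lintegral_bandIntegral {g : Euc (n + 1) → ℝ≥0∞} (hg : Measurable g) {K : ℝ}
    (hK : 0 < K)
    (hsub : ∀ (z : Euc (n + 1)) (R : ℝ), 0 < R → Metric.closedBall z R ⊆ upperHS n →
      g z ≤ ENNReal.ofReal (K * (R ^ (n + 1))⁻¹) * ∫⁻ w in Metric.ball z R, g w)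
    (β : ℝ) {ρ : ℝ} (hρ : 0 < ρ) {z : Euc (n + 1)} (hz : tp z ∈ Ioc ρ (2 * ρ)) :
    g z ≤ ENNReal.ofReal (K * 2 ^ (n + 1) * 4 ^ |β - 1| * ρ ^ (-(n + β))) *
      ∫⁻ y in Metric.ball (xp z) (ρ / 2), bandIntegral g β ρ y := by
  have hball : ∀ w ∈ Metric.closedBall z (ρ / 2), ρ / 2 < tp w ∧ tp w ≤ 4 * ρ := by
    intro w hw
    have := abs_le.1 ((abs_tp_sub_le w z).trans (Metric.mem_closedBall.1 hw))
    constructor <;> linarith [this.1, this.2, hz.1, hz.2]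
  have h1 := hsub z (ρ / 2) (by positivity)
    (fun w hw => show 0 < tp w by linarith [(hball w hw).1])
  have hmi : Measurable ((Metric.ball z (ρ / 2)).indicator g) := hg.indicator measurableSet_ball
  have h2 : ∫⁻ w in Metric.ball z (ρ / 2), g w ≤
      ENNReal.ofReal (4 ^ |β - 1| * ρ ^ (-(β - 1))) *
        ∫⁻ y in Metric.ball (xp z) (ρ / 2), bandIntegral g β ρ y := by
    rw [← lintegral_indicator measurableSet_ball, lintegral_eq_lintegral_pt hmi,
      ← lintegral_const_mul' _ _ ENNReal.ofReal_ne_top, ← lintegral_indicator measurableSet_ball]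
    refine lintegral_mono fun y => ?_
    by_cases hy : y ∈ Metric.ball (xp z) (ρ / 2)
    · rw [indicator_of_mem hy, bandIntegral, ← lintegral_const_mul' _ _ ENNReal.ofReal_ne_top,
        ← lintegral_indicator measurableSet_Ioc]
      refine lintegral_mono fun u => ?_
      by_cases hm : pt y u ∈ Metric.ball z (ρ / 2)
      swap
      · rw [indicator_of_notMem hm]
        exact zero_le
      rw [indicator_of_mem hm]
      have hu := hball _ (Metric.ball_subset_closedBall hm)
      rw [tp_pt] at hu
      rw [indicator_of_mem (show u ∈ Ioc (ρ / 2) (4 * ρ) from hu), mul_left_comm,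
        ← ENNReal.ofReal_mul (by positivity)]
      exact le_mul_of_one_le_right' (ENNReal.one_le_ofReal.2 (one_le_mul_rpow hρ hu _))
    · rw [indicator_of_notMem hy, nonpos_iff_eq_zero, lintegral_eq_zero_iff]
      · refine Filter.Eventually.of_forall fun u => ?_
        refine indicator_of_notMem (fun hm => hy ?_) g
        have := (dist_xp_le (pt y u) z).trans_lt hm
        simpa using this
      · exact hmi.comp (continuous_pt.measurable.comp measurable_prodMk_left)
  refine h1.trans ((mul_le_mul_right h2 _).trans_eq ?_)
  rw [← mul_assoc, ← ENNReal.ofReal_mul (by positivity)]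
  congr 2
  rw [show -((n : ℝ) + β) = -((n + 1 : ℕ) : ℝ) + -(β - 1) by push_cast; ring, rpow_add hρ,
    rpow_neg hρ.le ((n + 1 : ℕ) : ℝ), rpow_natCast, div_pow]
  field_simp

end HalfSpace

section Carleson

variable {n : ℕ}

theorem exists_rpow_le_lintegral_bandIntegral_rpow {K : ℝ} (hK : 0 < K) (β : ℝ) {q : ℝ}
    (hq : 1 ≤ q) :
    ∃ K' : ℝ, 0 < K' ∧ ∀ g : Euc (n + 1) → ℝ≥0∞, Measurable g →
      (∀ (z : Euc (n + 1)) (R : ℝ), 0 < R → Metric.closedBall z R ⊆ upperHS n →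
        g z ≤ ENNReal.ofReal (K * (R ^ (n + 1))⁻¹) * ∫⁻ w in Metric.ball z R, g w) →
      ∀ (ρ : ℝ), 0 < ρ → ∀ z : Euc (n + 1), tp z ∈ Ioc ρ (2 * ρ) →
      g z ^ q ≤ ENNReal.ofReal (K' * ρ ^ (-(n + β * q))) *
        ∫⁻ y in Metric.ball (xp z) (ρ / 2), bandIntegral g β ρ y ^ q := by
  set v : ℝ := (volume (Metric.ball (0 : Euc n) 1)).toReal
  have hv : 0 < v := ENNReal.toReal_pos (Metric.measure_ball_pos _ _ one_pos).ne'
    measure_ball_lt_top.ne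
  set K₁ := K * 2 ^ (n + 1) * 4 ^ |β - 1|
  have hK₁ : 0 < K₁ := by positivity
  refine ⟨K₁ ^ q * (v / 2 ^ n) ^ (q - 1), by positivity,
    fun g hg hsub ρ hρ z hz => ?_⟩
  have h1 := le_lintegral_bandIntegral hg hK hsub β hρ hz
  have hj := lintegral_rpow_le_measure_mul hq
    (measurable_bandIntegral hg β ρ).aemeasurable (ν := volume.restrict (Metric.ball (xp z) (ρ / 2)))
  have hvol : volume (Metric.ball (xp z) (ρ / 2)) = ENNReal.ofReal (ρ ^ (n : ℝ) * (v / 2 ^ n)) := by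
    rw [Measure.addHaar_ball_of_pos volume _ (half_pos hρ), rpow_natCast,
      show ρ ^ n * (v / 2 ^ n) = (ρ / 2) ^ n * v by rw [div_pow]; ring,
      ENNReal.ofReal_mul (by positivity), ENNReal.ofReal_toReal measure_ball_lt_top.ne]
    simp
  simp only [Measure.restrict_apply_univ, hvol] at hj
  calc g z ^ q ≤ _ := ENNReal.rpow_le_rpow h1 (by linarith)
    _ ≤ ENNReal.ofReal (K₁ * ρ ^ (-(n + β))) ^ q *
        (ENNReal.ofReal (ρ ^ (n : ℝ) * (v / 2 ^ n)) ^ (q - 1) *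
          ∫⁻ y in Metric.ball (xp z) (ρ / 2), bandIntegral g β ρ y ^ q) := by
        rw [ENNReal.mul_rpow_of_nonneg _ _ (by linarith)]
        gcongr
    _ = _ := by
        rw [ENNReal.ofReal_rpow_of_nonneg (by positivity) (by linarith),
          ENNReal.ofReal_rpow_of_nonneg (by positivity) (by linarith), ← mul_assoc,
          ← ENNReal.ofReal_mul (by positivity)]
        congr 2
        clear_value K₁
        rw [mul_rpow hK₁.le (by positivity), mul_rpow (by positivity) (by positivity),
          ← rpow_mul hρ.le, ← rpow_mul hρ.le, show -((n : ℝ) + β * q) = -(n + β) * q + n * (q - 1)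
          by ring, rpow_add hρ]
        ring

/-- The set of points with height in `(ρ, 2ρ]`. -/
def band (n : ℕ) (ρ : ℝ) : Set (Euc (n + 1)) := {z | tp z ∈ Ioc ρ (2 * ρ)}

theorem measurableSet_band (ρ : ℝ) : MeasurableSet (band n ρ) :=
  continuous_tp.measurable measurableSet_Ioc

theorem band_inter_subset_Qcube {ρ : ℝ} (y : Euc n) :
    band n ρ ∩ {z | dist (xp z) y ≤ ρ} ⊆ Qcube y (2 * ρ) := by
  rintro z ⟨h1, h2⟩
  refine ⟨fun i => ?_, ?_⟩
  · have h3 : |(xp z - y) i| ≤ ‖xp z - y‖ := by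
      simpa using PiLp.norm_apply_le (xp z - y) i
    rw [← dist_eq_norm] at h3
    have h4 : dist (xp z) y ≤ ρ := h2
    simp only [PiLp.sub_apply, xp_apply] at h3
    linarith
  · rw [abs_le]
    constructor <;> linarith [h1.1, h1.2]

theorem setLIntegral_band_rpow_le {μ : Measure (Euc (n + 1))} {C β q : ℝ} (hC : 0 < C)
    (hμ : ∀ (y : Euc n) (r : ℝ), 0 < r →
      μ (Qcube y r) ≤ ENNReal.ofReal (C * r ^ ((n : ℝ) + β * q)))
    {g : Euc (n + 1) → ℝ≥0∞} (hg : Measurable g) {K : ℝ} (hK : 0 < K) {ρ : ℝ} (hρ : 0 < ρ)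
    (hle : ∀ z : Euc (n + 1), tp z ∈ Ioc ρ (2 * ρ) →
      g z ^ q ≤ ENNReal.ofReal (K * ρ ^ (-(n + β * q))) *
        ∫⁻ y in Metric.ball (xp z) (ρ / 2), bandIntegral g β ρ y ^ q) :
    ∫⁻ z in band n ρ, g z ^ q ∂μ ≤
      ENNReal.ofReal (K * C * 2 ^ ((n : ℝ) + β * q)) * ∫⁻ y, bandIntegral g β ρ y ^ q := by
  have hloc : IsLocallyFiniteMeasure (μ.restrict (band n ρ)) := by
    refine ⟨fun z => ⟨{w | dist (xp w) (xp z) < ρ}, ?_, ?_⟩⟩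
    · refine IsOpen.mem_nhds (isOpen_lt (continuous_xp.dist continuous_const) continuous_const) ?_
      simpa using hρ
    · rw [Measure.restrict_apply (measurableSet_lt
        (continuous_xp.dist continuous_const).measurable measurable_const)]
      refine (measure_mono ?_).trans_lt ((hμ (xp z) (2 * ρ) (by positivity)).trans_lt
        ENNReal.ofReal_lt_top)
      exact fun w hw => band_inter_subset_Qcube (xp z) ⟨hw.2, le_of_lt (a := dist (xp w) (xp z)) hw.1⟩
  have hG := measurable_bandIntegral hg β ρ
  let S : Set (Euc (n + 1) × Euc n) := {a | dist a.2 (xp a.1) < ρ / 2}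
  have hS : MeasurableSet S :=
    measurableSet_lt (continuous_snd.dist (continuous_xp.comp continuous_fst)).measurable
      measurable_const
  have hF : Measurable (S.indicator fun a => bandIntegral g β ρ a.2 ^ q) :=
    ((hG.comp measurable_snd).pow_const q).indicator hS
  have e1 : ∀ z : Euc (n + 1), ∫⁻ y in Metric.ball (xp z) (ρ / 2), bandIntegral g β ρ y ^ q =
      ∫⁻ y, S.indicator (fun a => bandIntegral g β ρ a.2 ^ q) (z, y) := by
    intro z
    rw [← lintegral_indicator measurableSet_ball]
    rfl
  calc ∫⁻ z in band n ρ, g z ^ q ∂μ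
      ≤ ∫⁻ z in band n ρ, (ENNReal.ofReal (K * ρ ^ (-(n + β * q))) *
        ∫⁻ y, S.indicator (fun a => bandIntegral g β ρ a.2 ^ q) (z, y)) ∂μ := by
        refine setLIntegral_mono' (measurableSet_band ρ) fun z hz => ?_
        rw [← e1]
        exact hle z hz
    _ = ENNReal.ofReal (K * ρ ^ (-(n + β * q))) * ∫⁻ y, ∫⁻ z in band n ρ,
        S.indicator (fun a => bandIntegral g β ρ a.2 ^ q) (z, y) ∂μ := by
        rw [lintegral_const_mul' _ _ ENNReal.ofReal_ne_top, lintegral_lintegral_swap]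
        exact hF.aemeasurable
    _ ≤ ENNReal.ofReal (K * ρ ^ (-(n + β * q))) * ∫⁻ y, bandIntegral g β ρ y ^ q *
        ENNReal.ofReal (C * (2 * ρ) ^ ((n : ℝ) + β * q)) := by
        gcongr with y
        have hm : MeasurableSet {z : Euc (n + 1) | dist y (xp z) < ρ / 2} :=
          measurableSet_lt (continuous_const.dist continuous_xp).measurable measurable_const
        calc ∫⁻ z in band n ρ, S.indicator (fun a => bandIntegral g β ρ a.2 ^ q) (z, y) ∂μ
            = ∫⁻ z in band n ρ, {z : Euc (n + 1) | dist y (xp z) < ρ / 2}.indicator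
              (fun _ => bandIntegral g β ρ y ^ q) z ∂μ := rfl
          _ = bandIntegral g β ρ y ^ q * μ ({z | dist y (xp z) < ρ / 2} ∩ band n ρ) := by
              rw [lintegral_indicator_const hm, Measure.restrict_apply hm]
          _ ≤ _ := by
              gcongr
              refine (measure_mono fun z hz => ?_).trans (hμ y (2 * ρ) (by positivity))
              refine band_inter_subset_Qcube y ⟨hz.2, ?_⟩
              have : dist y (xp z) < ρ / 2 := hz.1
              rw [mem_ofPred_eq, dist_comm]
              linarith
    _ = _ := by
        rw [lintegral_mul_const' _ _ ENNReal.ofReal_ne_top, mul_comm (∫⁻ y, _), ← mul_assoc,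
          ← ENNReal.ofReal_mul (by positivity)]
        congr 2
        rw [mul_rpow two_pos.le hρ.le, rpow_neg hρ.le]
        field_simp

theorem tsum_rpow_le_rpow_tsum {ι : Type*} (a : ι → ℝ≥0∞) {q : ℝ} (hq : 1 ≤ q) :
    ∑' i, a i ^ q ≤ (∑' i, a i) ^ q := by
  classical
  refine ENNReal.summable.tsum_le_of_sum_le fun s => ?_
  refine le_trans ?_ (ENNReal.rpow_le_rpow (ENNReal.sum_le_tsum s) (by linarith))
  induction s using Finset.induction_on with
  | empty => simp
  | insert i s hi ih =>
    rw [Finset.sum_insert hi, Finset.sum_insert hi]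
    exact (add_le_add_right ih _).trans (ENNReal.add_rpow_le_rpow_add _ _ hq)

theorem tsum_bandIntegral_le (g : Euc (n + 1) → ℝ≥0∞) (β : ℝ) (y : Euc n) :
    ∑' j : ℤ, bandIntegral g β (2 ^ j) y ≤
      3 * ∫⁻ u in Ioi 0, g (pt y u) * ENNReal.ofReal (u ^ (β - 1)) := by
  set h : ℝ → ℝ≥0∞ := fun u => g (pt y u) * ENNReal.ofReal (u ^ (β - 1))
  set e : ℤ → ℝ≥0∞ := fun j => ∫⁻ u in Ioc ((2 : ℝ) ^ j) (2 ^ (j + 1)), h u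
  have h1 : ∀ j : ℤ, bandIntegral g β (2 ^ j) y ≤ e (j - 1) + e j + e (j + 1) := by
    intro j
    have hp : (0 : ℝ) < 2 ^ j := by positivity
    have s1 : Ioc ((2 : ℝ) ^ j / 2) (4 * 2 ^ j) = Ioc ((2 : ℝ) ^ (j - 1)) (2 ^ (j - 1 + 1)) ∪
        Ioc ((2 : ℝ) ^ j) (2 ^ (j + 1)) ∪ Ioc ((2 : ℝ) ^ (j + 1)) (2 ^ (j + 1 + 1)) := by
      have e1 : (2 : ℝ) ^ (j - 1) = 2 ^ j / 2 := zpow_sub_one₀ two_ne_zero j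
      have e2 : (2 : ℝ) ^ (j + 1) = 2 ^ j * 2 := zpow_add_one₀ two_ne_zero j
      have e3 : (2 : ℝ) ^ (j + 1 + 1) = 2 ^ j * 2 * 2 := by
        rw [zpow_add_one₀ two_ne_zero, e2]
      rw [sub_add_cancel, Ioc_union_Ioc_eq_Ioc, Ioc_union_Ioc_eq_Ioc, e1, e3]
      · ring_nf
      all_goals linarith
    rw [bandIntegral, s1]
    exact (lintegral_union_le _ _ _).trans (add_le_add_left (lintegral_union_le _ _ _) _)
  have h2 : ∑' j, e j ≤ ∫⁻ u in Ioi 0, h u := by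
    rw [← lintegral_iUnion (fun _ => measurableSet_Ioc)
      (by simpa using (zpow_right_mono₀ (one_le_two (α := ℝ))).pairwise_disjoint_on_Ioc_succ)]
    refine lintegral_mono_set (iUnion_subset fun j u hu => ?_)
    exact lt_trans (by positivity) hu.1
  calc ∑' j : ℤ, bandIntegral g β (2 ^ j) y
      ≤ ∑' j, (e (j - 1) + e j + e (j + 1)) := ENNReal.tsum_le_tsum h1
    _ = ∑' j, e j + ∑' j, e j + ∑' j, e j := by
        have t1 : ∑' j, e (j - 1) = ∑' j, e j := (Equiv.subRight (1 : ℤ)).tsum_eq e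
        have t2 : ∑' j, e (j + 1) = ∑' j, e j := (Equiv.addRight (1 : ℤ)).tsum_eq e
        rw [ENNReal.tsum_add, ENNReal.tsum_add, t1, t2]
    _ = 3 * ∑' j, e j := by ring
    _ ≤ _ := by gcongr

theorem exists_setLIntegral_rpow_le {μ : Measure (Euc (n + 1))} {C β q : ℝ} (hC : 0 < C)
    (hq : 1 ≤ q)
    (hμ : ∀ (y : Euc n) (r : ℝ), 0 < r →
      μ (Qcube y r) ≤ ENNReal.ofReal (C * r ^ ((n : ℝ) + β * q))) {K : ℝ} (hK : 0 < K) :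
    ∃ C' : ℝ, 0 < C' ∧ ∀ g : Euc (n + 1) → ℝ≥0∞, Measurable g →
      (∀ (z : Euc (n + 1)) (R : ℝ), 0 < R → Metric.closedBall z R ⊆ upperHS n →
        g z ≤ ENNReal.ofReal (K * (R ^ (n + 1))⁻¹) * ∫⁻ w in Metric.ball z R, g w) →
      ∫⁻ z in upperHS n, g z ^ q ∂μ ≤ ENNReal.ofReal C' *
        ∫⁻ y, (∫⁻ u in Ioi 0, g (pt y u) * ENNReal.ofReal (u ^ (β - 1))) ^ q := by
  obtain ⟨K₁, hK₁, hle⟩ := exists_rpow_le_lintegral_bandIntegral_rpow (n := n) hK β hq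
  refine ⟨K₁ * C * 2 ^ ((n : ℝ) + β * q) * 3 ^ q, by positivity, fun g hg hsub => ?_⟩
  have hcov : upperHS n ⊆ ⋃ j : ℤ, band n ((2 : ℝ) ^ j) := by
    intro z hz
    obtain ⟨j, hj⟩ := exists_mem_Ioc_zpow (show 0 < tp z from hz) (one_lt_two (α := ℝ))
    refine mem_iUnion.2 ⟨j, hj.1, ?_⟩
    rw [zpow_add_one₀ two_ne_zero] at hj
    linarith [hj.2]
  calc ∫⁻ z in upperHS n, g z ^ q ∂μ
      ≤ ∑' j : ℤ, ∫⁻ z in band n ((2 : ℝ) ^ j), g z ^ q ∂μ :=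
        (lintegral_mono_set hcov).trans (lintegral_iUnion_le _ _)
    _ ≤ ∑' j : ℤ, ENNReal.ofReal (K₁ * C * 2 ^ ((n : ℝ) + β * q)) *
          ∫⁻ y, bandIntegral g β (2 ^ j) y ^ q :=
        ENNReal.tsum_le_tsum fun j => setLIntegral_band_rpow_le hC hμ hg hK₁ (by positivity)
          (hle g hg hsub _ (by positivity))
    _ = ENNReal.ofReal (K₁ * C * 2 ^ ((n : ℝ) + β * q)) *
          ∫⁻ y, ∑' j : ℤ, bandIntegral g β (2 ^ j) y ^ q := by
        rw [ENNReal.tsum_mul_left, lintegral_tsum]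
        exact fun j => ((measurable_bandIntegral hg β _).pow_const q).aemeasurable
    _ ≤ ENNReal.ofReal (K₁ * C * 2 ^ ((n : ℝ) + β * q)) * ∫⁻ y, ENNReal.ofReal (3 ^ q) *
          (∫⁻ u in Ioi 0, g (pt y u) * ENNReal.ofReal (u ^ (β - 1))) ^ q := by
        gcongr with y
        refine (tsum_rpow_le_rpow_tsum _ hq).trans ?_
        refine (ENNReal.rpow_le_rpow (tsum_bandIntegral_le g β y) (by linarith)).trans_eq ?_
        rw [ENNReal.mul_rpow_of_nonneg _ _ (by linarith),
          ← ENNReal.ofReal_rpow_of_nonneg (by norm_num) (by linarith)]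
        simp
    _ = _ := by
        rw [lintegral_const_mul' _ _ ENNReal.ofReal_ne_top, ← mul_assoc,
          ← ENNReal.ofReal_mul (by positivity)]

end Carleson

section Embedding

variable {n : ℕ}

theorem normF_rpow (f : Euc (n + 1) → ℝ) {p : ℝ} (hp : 0 < p) (τ α : ℝ) :
    normF n f p τ α ^ p = ∫⁻ x : Euc n,
      (∫⁻ t in Ioi (0 : ℝ), ENNReal.ofReal (|f (pt x t)| ^ τ * t ^ (α * τ - 1))) ^ (p / τ) := by
  rw [normF, ← ENNReal.rpow_mul, one_div_mul_cancel hp.ne', ENNReal.rpow_one]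

theorem exists_embedding_of_carleson {τ p α : ℝ} (hτ : 0 < τ) (hτp : τ ≤ p)
    {μ : Measure (Euc (n + 1))} {C : ℝ} (hC : 0 < C)
    (hμ : ∀ (y : Euc n) (r : ℝ), 0 < r →
      μ (Qcube y r) ≤ ENNReal.ofReal (C * r ^ ((n : ℝ) + α * p))) :
    ∃ C' : ℝ, 0 < C' ∧ ∀ f : Euc (n + 1) → ℝ, HarmonicOnE f (upperHS n) →
      (∫⁻ z in upperHS n, ENNReal.ofReal (|f z| ^ p) ∂μ) ≤
        ENNReal.ofReal C' * (normF n f p τ α) ^ p := by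
  have hp : 0 < p := hτ.trans_le hτp
  have hq : 1 ≤ p / τ := (one_le_div hτ).2 hτp
  obtain ⟨K, hK, hsub⟩ := exists_rpow_le_lintegral_ball n.succ_pos hτ
  obtain ⟨C', hC', h⟩ := exists_setLIntegral_rpow_le (β := α * τ) hC hq
    (by rwa [show α * τ * (p / τ) = α * p by field_simp]) hK
  refine ⟨C', hC', fun f hf => ?_⟩
  have hm : MeasurableSet (upperHS n) := isOpen_upperHS.measurableSet
  set g : Euc (n + 1) → ℝ≥0∞ := (upperHS n).indicator fun z => ENNReal.ofReal (|f z| ^ τ)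
  have hg : Measurable g := by
    have hc : ContinuousOn (fun z => ENNReal.ofReal (|f z| ^ τ)) (upperHS n) :=
      ENNReal.continuous_ofReal.comp_continuousOn
        (hf.1.continuousOn.abs.rpow_const fun _ _ => Or.inr hτ.le)
    classical
    have := hc.measurable_piecewise (continuousOn_const (c := (0 : ℝ≥0∞))) hm
    rwa [show (fun _ => (0 : ℝ≥0∞)) = (0 : Euc (n + 1) → ℝ≥0∞) from rfl,
      piecewise_eq_indicator] at this
  have hgf : ∀ z ∈ upperHS n, g z = ENNReal.ofReal (|f z| ^ τ) := fun z hz =>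
    indicator_of_mem hz _
  have := h g hg fun z R hR hz => by
    rw [hgf z (hz (Metric.mem_closedBall_self hR.le)), setLIntegral_congr_fun measurableSet_ball
      fun w hw => hgf w (hz (Metric.ball_subset_closedBall hw))]
    exact hsub f _ isOpen_upperHS hf z R hR hz
  rw [normF_rpow f hp]
  calc ∫⁻ z in upperHS n, ENNReal.ofReal (|f z| ^ p) ∂μ
      = ∫⁻ z in upperHS n, g z ^ (p / τ) ∂μ := by
        refine setLIntegral_congr_fun hm fun z hz => ?_
        simp only [hgf z hz]
        rw [ENNReal.ofReal_rpow_of_nonneg (by positivity) (by positivity),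
          ← rpow_mul (abs_nonneg _), mul_div_cancel₀ _ hτ.ne']
    _ ≤ _ := this
    _ = _ := by
        congr 2
        ext x
        congr 1
        refine setLIntegral_congr_fun measurableSet_Ioi fun t ht => ?_
        simp only [hgf (pt x t) (by simpa [upperHS] using ht)]
        rw [ENNReal.ofReal_mul (by positivity)]

end Embedding

section IsotropicKernel

variable {N : ℕ}

theorem hasDerivAt_fderiv_line {E : Type*} [NormedAddCommGroup E] [NormedSpace ℝ E] {f : E → ℝ}
    {z v : E} (hf : DifferentiableAt ℝ (fderiv ℝ f) z) :
    HasDerivAt (fun s : ℝ => fderiv ℝ f (z + s • v) v) (fderiv ℝ (fderiv ℝ f) z v v) 0 := by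
  have hl : HasDerivAt (fun s : ℝ => z + s • v) v 0 := by
    simpa using ((hasDerivAt_id (0 : ℝ)).smul_const v).const_add z
  have h : HasFDerivAt (fderiv ℝ f) (fderiv ℝ (fderiv ℝ f) z) (z + (0 : ℝ) • v) := by
    rw [zero_smul, add_zero]
    exact hf.hasFDerivAt
  have h' : HasDerivAt (fun s : ℝ => fderiv ℝ f (z + s • v)) (fderiv ℝ (fderiv ℝ f) z v) 0 :=
    h.comp_hasDerivAt (0 : ℝ) hl
  simpa using h'.clm_apply (hasDerivAt_const (0 : ℝ) v)

theorem d2_eq_of_hasDerivAt_line {f : Euc N → ℝ} {z v : Euc N} {ψ : ℝ → ℝ} {c : ℝ}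
    (hf : ContDiffAt ℝ 2 f z)
    (h1 : ∀ᶠ s in nhds (0 : ℝ), HasDerivAt (fun s : ℝ => f (z + s • v)) (ψ s) s)
    (h2 : HasDerivAt ψ c 0) : d2 f z v = c := by
  have hl : ∀ s : ℝ, HasDerivAt (fun s : ℝ => z + s • v) v s := fun s => by
    simpa using ((hasDerivAt_id s).smul_const v).const_add z
  have hl0 : Filter.Tendsto (fun s : ℝ => z + s • v) (nhds 0) (nhds z) := by
    simpa using (hl 0).continuousAt.tendsto
  have hd : ∀ᶠ w in nhds z, DifferentiableAt ℝ f w :=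
    (hf.eventually (by simp)).mono fun w hw => hw.differentiableAt (by norm_num)
  have e : ψ =ᶠ[nhds 0] fun s => fderiv ℝ f (z + s • v) v := by
    filter_upwards [h1, hl0.eventually hd] with s hs hs'
    exact hs.unique (hs'.hasFDerivAt.comp_hasDerivAt s (hl s))
  have hdd : DifferentiableAt ℝ (fderiv ℝ f) z :=
    (hf.fderiv_right (m := 1) (by norm_num)).differentiableAt (by norm_num)
  rw [d2_eq_fderiv_fderiv]
  exact ((hasDerivAt_fderiv_line hdd).congr_of_eventuallyEq e).unique h2

/-- The linear form with complex coefficients `a`. -/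
noncomputable def linForm (a : Fin N → ℂ) (z : Euc N) : ℂ := ∑ i, a i * (z i : ℂ)

/-- The product of the real part of a power of a linear form and a power of the norm; it is
harmonic away from the origin when the linear form is isotropic and the powers match. -/
noncomputable def kelvin (a : Fin N → ℂ) (k : ℕ) (β : ℝ) (z : Euc N) : ℝ :=
  (linForm a z ^ k).re * (‖z‖ ^ 2) ^ β

theorem contDiff_linForm (a : Fin N → ℂ) : ContDiff ℝ 2 (linForm a) := by
  unfold linForm
  refine ContDiff.sum fun i _ => contDiff_const.mul ?_
  exact Complex.ofRealCLM.contDiff.comp (by fun_prop)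

theorem linForm_add_smul_single (a : Fin N → ℂ) (z : Euc N) (s : ℝ) (i : Fin N) :
    linForm a (z + s • EuclideanSpace.single i 1) = linForm a z + s * a i := by
  simp [linForm, mul_add, Finset.sum_add_distrib, mul_comm, apply_ite Complex.ofReal]

theorem norm_sq_add_smul_single (z : Euc N) (s : ℝ) (i : Fin N) :
    ‖z + s • EuclideanSpace.single i (1 : ℝ)‖ ^ 2 = ‖z‖ ^ 2 + 2 * z i * s + s ^ 2 := by
  rw [norm_add_sq_real, norm_smul, inner_smul_right]
  simp [EuclideanSpace.inner_single_right]
  ring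

theorem contDiffAt_kelvin (a : Fin N → ℂ) (k : ℕ) (β : ℝ) {z : Euc N} (hz : z ≠ 0) :
    ContDiffAt ℝ 2 (kelvin a k β) z := by
  unfold kelvin
  refine ContDiffAt.mul ?_ ?_
  · exact (Complex.reCLM.contDiff.comp ((contDiff_linForm a).pow k)).contDiffAt
  · exact (contDiff_norm_sq ℝ).contDiffAt.rpow_const_of_ne (by simpa using hz)

theorem d2_kelvin (a : Fin N → ℂ) (k : ℕ) (β : ℝ) {z : Euc N} (hz : z ≠ 0) (i : Fin N) :
    d2 (kelvin a k β) z (EuclideanSpace.single i 1) =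
      (k * (k - 1 : ℕ) * linForm a z ^ (k - 2) * a i ^ 2).re * (‖z‖ ^ 2) ^ β +
      4 * β * (k * linForm a z ^ (k - 1) * (a i * z i)).re * (‖z‖ ^ 2) ^ (β - 1) +
      (linForm a z ^ k).re * (4 * β * (β - 1) * z i ^ 2 * (‖z‖ ^ 2) ^ (β - 2) +
        2 * β * (‖z‖ ^ 2) ^ (β - 1)) := by
  have hρ : 0 < ‖z‖ ^ 2 := by positivity
  have hA : ∀ (m : ℕ) (s : ℝ), HasDerivAt (fun s : ℝ => (linForm a z + s * a i) ^ m)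
      (m * (linForm a z + s * a i) ^ (m - 1) * a i) s := fun m s => by
    have : HasDerivAt (fun s : ℝ => linForm a z + s * a i) (a i) s := by
      simpa using ((Complex.ofRealCLM.hasDerivAt (x := s)).mul_const (a i)).const_add (linForm a z)
    exact this.pow m
  have hR : ∀ (s : ℝ), HasDerivAt (fun s : ℝ => ‖z‖ ^ 2 + 2 * z i * s + s ^ 2)
      (2 * z i + 2 * s) s := fun s => by
    refine HasDerivAt.congr_deriv (f' := 2 * z i * 1 + (2 : ℕ) * s ^ (2 - 1) * 1) ?_ (by simp)
    exact (((hasDerivAt_id s).const_mul (2 * z i)).const_add (‖z‖ ^ 2)).add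
      ((hasDerivAt_id' s).pow 2)
  have hre : ∀ {g : ℝ → ℂ} {g' : ℂ} {s : ℝ}, HasDerivAt g g' s →
      HasDerivAt (fun s => (g s).re) g'.re s := fun h =>
    Complex.reCLM.hasFDerivAt.comp_hasDerivAt _ h
  have hpos : ∀ᶠ s in nhds (0 : ℝ), 0 < ‖z‖ ^ 2 + 2 * z i * s + s ^ 2 := by
    refine (hR 0).continuousAt.eventually_const_lt ?_
    simpa using hρ
  refine d2_eq_of_hasDerivAt_line (contDiffAt_kelvin a k β hz)
    (ψ := fun s => (k * (linForm a z + s * a i) ^ (k - 1) * a i).re *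
      (‖z‖ ^ 2 + 2 * z i * s + s ^ 2) ^ β + ((linForm a z + s * a i) ^ k).re *
      ((2 * z i + 2 * s) * β * (‖z‖ ^ 2 + 2 * z i * s + s ^ 2) ^ (β - 1))) ?_ ?_
  · filter_upwards [hpos] with s hs
    simp only [kelvin, linForm_add_smul_single, norm_sq_add_smul_single]
    exact (hre (hA k s)).mul ((hR s).rpow_const (Or.inl hs.ne'))
  · have h0 := hpos.self_of_nhds
    have h1 := (hre (((hA (k - 1) 0).const_mul (k : ℂ)).mul_const (a i))).mul
      ((hR 0).rpow_const (p := β) (Or.inl h0.ne'))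
    have h2 := (hre (hA k 0)).mul (((((hasDerivAt_id (0 : ℝ)).const_mul 2).const_add
      (2 * z i)).mul_const β).mul ((hR 0).rpow_const (p := β - 1) (Or.inl h0.ne')))
    refine (h1.add h2).congr_deriv ?_
    simp only [id, Pi.mul_apply, Complex.ofReal_zero, zero_mul, add_zero, mul_zero, mul_one, ne_eq,
      OfNat.ofNat_ne_zero, not_false_eq_true, zero_pow]
    rw [show β - 1 - 1 = β - 2 by ring, show k - 1 - 1 = k - 2 by omega]
    rw [show (k : ℂ) * ((k - 1 : ℕ) * linForm a z ^ (k - 2) * a i) * a i =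
      k * (k - 1 : ℕ) * linForm a z ^ (k - 2) * a i ^ 2 by ring,
      show (k : ℂ) * linForm a z ^ (k - 1) * (a i * z i) =
        (k * linForm a z ^ (k - 1) * a i) * z i by ring, Complex.re_mul_ofReal]
    ring

theorem sum_d2_kelvin {a : Fin N → ℂ} (ha : ∑ i, a i ^ 2 = 0) {k : ℕ} {β : ℝ}
    (hβ : 2 * k + 2 * (β - 1) + N = 0) {z : Euc N} (hz : z ≠ 0) :
    ∑ i, d2 (kelvin a k β) z (EuclideanSpace.single i 1) = 0 := by
  have hρ : 0 < ‖z‖ ^ 2 := by positivity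
  simp only [d2_kelvin a k β hz, Finset.sum_add_distrib, ← Finset.sum_mul, ← Finset.mul_sum,
    ← Complex.re_sum, ha, Finset.sum_const, Finset.card_univ, Fintype.card_fin]
  have e1 : ∑ i, a i * (z i : ℂ) = linForm a z := rfl
  have e2 : ∑ i, z i ^ 2 = ‖z‖ ^ 2 := by simp [EuclideanSpace.norm_sq_eq]
  have e3 : (‖z‖ ^ 2) ^ (β - 1) = ‖z‖ ^ 2 * (‖z‖ ^ 2) ^ (β - 2) := by
    rw [show β - 1 = 1 + (β - 2) by ring, rpow_add hρ, rpow_one]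
  have e4 : ((k : ℂ) * linForm a z ^ (k - 1) * linForm a z).re = k * (linForm a z ^ k).re := by
    rcases k with _ | k
    · simp
    · rw [mul_assoc, Nat.add_sub_cancel, ← pow_succ, ← Complex.ofReal_natCast,
        Complex.re_ofReal_mul]
  rw [e1, e2, e4, e3]
  simp only [mul_zero, Complex.zero_re, zero_mul, zero_add, nsmul_eq_mul]
  linear_combination 2 * β * (linForm a z ^ k).re * ‖z‖ ^ 2 * (‖z‖ ^ 2) ^ (β - 2) * hβ

theorem harmonicOnE_kelvin_sub {a : Fin N → ℂ} (ha : ∑ i, a i ^ 2 = 0) {k : ℕ} {β : ℝ}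
    (hβ : 2 * k + 2 * (β - 1) + N = 0) {s : Set (Euc N)} {w : Euc N} (hw : w ∉ s) :
    HarmonicOnE (fun z => kelvin a k β (z - w)) s := by
  have hne : ∀ z ∈ s, z - w ≠ 0 := fun z hz h => hw (sub_eq_zero.1 h ▸ hz)
  refine ⟨fun z hz => ?_, fun z hz => ?_⟩
  · exact (ContDiffAt.comp (g := kelvin a k β) (f := fun z => z - w) z
      (contDiffAt_kelvin a k β (hne z hz)) (by fun_prop)).contDiffWithinAt
  · have : ∀ v, d2 (fun z => kelvin a k β (z - w)) z v = d2 (kelvin a k β) (z - w) v := fun v => by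
      simp only [d2, iteratedFDeriv_comp_sub]
    simp only [this]
    exact sum_d2_kelvin ha hβ (hne z hz)

theorem kelvin_smul (a : Fin N → ℂ) (k : ℕ) (β : ℝ) {r : ℝ} (hr : 0 < r) (z : Euc N) :
    kelvin a k β (r • z) = r ^ (k + 2 * β) * kelvin a k β z := by
  have e : linForm a (r • z) = r * linForm a z := by
    simp only [linForm, Finset.mul_sum]
    refine Finset.sum_congr rfl fun i _ => ?_
    simp; ring
  rw [kelvin, kelvin, e, mul_pow, ← Complex.ofReal_pow, Complex.re_ofReal_mul, norm_smul,
    mul_pow, mul_rpow (by positivity) (by positivity), norm_of_nonneg hr.le, rpow_add hr,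
    rpow_natCast, rpow_mul hr.le, rpow_two]
  ring

theorem abs_kelvin_le {a : Fin N → ℂ} (h : ∀ z, ‖linForm a z‖ ≤ ‖z‖) (k : ℕ) (β : ℝ)
    {z : Euc N} (hz : z ≠ 0) : |kelvin a k β z| ≤ ‖z‖ ^ (k + 2 * β) := by
  have h0 : 0 < ‖z‖ := norm_pos_iff.2 hz
  rw [kelvin, abs_mul, abs_of_nonneg (a := (‖z‖ ^ 2) ^ β) (by positivity), rpow_add h0,
    rpow_natCast, rpow_mul h0.le, rpow_two]
  gcongr
  calc |(linForm a z ^ k).re| ≤ ‖linForm a z ^ k‖ := Complex.abs_re_le_norm _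
    _ = ‖linForm a z‖ ^ k := norm_pow _ _
    _ ≤ _ := by gcongr; exact h z

end IsotropicKernel

section KernelBounds

variable {n : ℕ}

theorem lintegral_Ioi_add_rpow_mul_rpow_le {γ δ s : ℝ} (hγ : 0 < γ) (hδ : γ < δ) (hs : 0 < s) :
    ∫⁻ t in Ioi (0 : ℝ), ENNReal.ofReal ((t + s) ^ (-δ) * t ^ (γ - 1)) ≤
      ENNReal.ofReal ((1 / γ + 1 / (δ - γ)) * s ^ (γ - δ)) := by
  have hδ' : 0 < δ - γ := sub_pos.2 hδ
  rw [← Ioc_union_Ioi_eq_Ioi hs.le, lintegral_union measurableSet_Ioi (Ioc_disjoint_Ioi le_rfl),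
    add_mul, ENNReal.ofReal_add (by positivity) (by positivity)]
  refine add_le_add ?_ ?_
  · have hi : IntegrableOn (fun t : ℝ => t ^ (γ - 1)) (Ioc 0 s) :=
      (intervalIntegrable_iff_integrableOn_Ioc_of_le hs.le).1
        (intervalIntegral.intervalIntegrable_rpow' (by linarith))
    calc ∫⁻ t in Ioc 0 s, ENNReal.ofReal ((t + s) ^ (-δ) * t ^ (γ - 1))
        ≤ ∫⁻ t in Ioc 0 s, ENNReal.ofReal (s ^ (-δ) * t ^ (γ - 1)) := by
          refine setLIntegral_mono' measurableSet_Ioc fun t ht => ?_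
          have ht0 : 0 < t := ht.1
          refine ENNReal.ofReal_le_ofReal (mul_le_mul_of_nonneg_right ?_ (by positivity))
          exact rpow_le_rpow_of_nonpos hs (by linarith) (by linarith)
      _ = ENNReal.ofReal (∫ t in Ioc 0 s, s ^ (-δ) * t ^ (γ - 1)) := by
          refine (ofReal_integral_eq_lintegral_ofReal (hi.const_mul _) ?_).symm
          filter_upwards [ae_restrict_mem measurableSet_Ioc] with t ht
          have ht0 : 0 < t := ht.1
          simp only [Pi.zero_apply]
          positivity
      _ = _ := by
          rw [integral_const_mul, ← intervalIntegral.integral_of_le hs.le,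
            integral_rpow (Or.inl (by linarith)), sub_add_cancel, zero_rpow hγ.ne',
            show γ - δ = -δ + γ by ring, rpow_add hs]
          congr 1
          ring
  · have hi := integrableOn_Ioi_rpow_of_lt (show γ - 1 - δ < -1 by linarith) hs
    calc ∫⁻ t in Ioi s, ENNReal.ofReal ((t + s) ^ (-δ) * t ^ (γ - 1))
        ≤ ∫⁻ t in Ioi s, ENNReal.ofReal (t ^ (γ - 1 - δ)) := by
          refine setLIntegral_mono' measurableSet_Ioi fun t ht => ?_
          have ht0 : 0 < t := hs.trans ht
          rw [show γ - 1 - δ = -δ + (γ - 1) by ring, rpow_add ht0]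
          refine ENNReal.ofReal_le_ofReal (mul_le_mul_of_nonneg_right ?_ (by positivity))
          exact rpow_le_rpow_of_nonpos ht0 (by linarith) (by linarith)
      _ = ENNReal.ofReal (∫ t in Ioi s, t ^ (γ - 1 - δ)) := by
          refine (ofReal_integral_eq_lintegral_ofReal hi ?_).symm
          filter_upwards [ae_restrict_mem measurableSet_Ioi] with t ht
          have ht0 : 0 < t := hs.trans ht
          simp only [Pi.zero_apply]
          positivity
      _ = _ := by
          rw [integral_Ioi_rpow_of_lt (by linarith) hs, show γ - 1 - δ + 1 = -(δ - γ) by ring,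
            show γ - δ = -(δ - γ) by ring, neg_div_neg_eq]
          congr 1
          ring

theorem exists_lintegral_norm_sub_add_rpow_le {q : ℝ} (hq : n < q) :
    ∃ c : ℝ, 0 < c ∧ ∀ (y : Euc n) (s : ℝ), 0 < s →
      ∫⁻ x : Euc n, ENNReal.ofReal ((‖x - y‖ + s) ^ (-q)) ≤
        ENNReal.ofReal (c * s ^ ((n : ℝ) - q)) := by
  have hfin : ∫⁻ x : Euc n, ENNReal.ofReal ((1 + ‖x‖) ^ (-q)) < ⊤ :=
    finite_integral_one_add_norm (by simpa using hq)
  set I := ∫⁻ x : Euc n, ENNReal.ofReal ((1 + ‖x‖) ^ (-q))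
  refine ⟨I.toReal + 1, by positivity, fun y s hs => ?_⟩
  rw [lintegral_sub_right_eq_self (fun x : Euc n => ENNReal.ofReal ((‖x‖ + s) ^ (-q))) y]
  have e : ∀ x : Euc n, ENNReal.ofReal ((‖x‖ + s) ^ (-q)) =
      ENNReal.ofReal (s ^ (-q)) * ENNReal.ofReal ((1 + ‖s⁻¹ • x‖) ^ (-q)) := fun x => by
    rw [← ENNReal.ofReal_mul (by positivity), ← mul_rpow hs.le (by positivity), norm_smul,
      norm_of_nonneg (inv_nonneg.2 hs.le)]
    congr 2
    field_simp
    ring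
  have hm : Measurable fun x : Euc n => ENNReal.ofReal ((1 + ‖x‖) ^ (-q)) := by fun_prop
  simp only [e]
  rw [lintegral_const_mul' _ _ ENNReal.ofReal_ne_top,
    lintegral_comp_smul_of_pos hm (inv_pos.2 hs), ← mul_assoc,
    ← ENNReal.ofReal_mul (by positivity), inv_pow, inv_inv,
    show s ^ (-q) * s ^ n = s ^ ((n : ℝ) - q) by
      rw [show (n : ℝ) - q = -q + n by ring, rpow_add hs, rpow_natCast],
    mul_comm (I.toReal + 1), ENNReal.ofReal_mul (by positivity)]
  gcongr
  exact (ENNReal.ofReal_toReal hfin.ne).symm.trans_le (ENNReal.ofReal_le_ofReal (by linarith))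

theorem exists_normF_rpow_le {τ p α a b K : ℝ} (hτ : 0 < τ) (hp : 0 < p) (hα : 0 < α)
    (hb : α < b) (ha : n < a * p) (hK : 0 < K) :
    ∃ K' : ℝ, 0 < K' ∧ ∀ (f : Euc (n + 1) → ℝ) (y : Euc n) (s : ℝ), 0 < s →
      (∀ x t, 0 < t → |f (pt x t)| ≤ K * ((‖x - y‖ + s) ^ (-a) * (t + s) ^ (-b))) →
      normF n f p τ α ^ p ≤ ENNReal.ofReal (K' * s ^ ((n : ℝ) + α * p - (a + b) * p)) := by
  obtain ⟨c, hc, h⟩ := exists_lintegral_norm_sub_add_rpow_le ha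
  have hbα : 0 < b - α := sub_pos.2 hb
  have hbτ : 0 < b * τ - α * τ := by rw [← sub_mul]; positivity
  set d : ℝ := 1 / (α * τ) + 1 / (b * τ - α * τ)
  have hd : 0 < d := by positivity
  refine ⟨(K ^ τ * d) ^ (p / τ) * c, by positivity, fun f y s hs hf => ?_⟩
  have hin : ∀ x, ∫⁻ t in Ioi (0 : ℝ), ENNReal.ofReal (|f (pt x t)| ^ τ * t ^ (α * τ - 1)) ≤
      ENNReal.ofReal (K ^ τ * d * s ^ (α * τ - b * τ) * (‖x - y‖ + s) ^ (-(a * τ))) := fun x => by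
    have hr : 0 < ‖x - y‖ + s := by positivity
    calc ∫⁻ t in Ioi (0 : ℝ), ENNReal.ofReal (|f (pt x t)| ^ τ * t ^ (α * τ - 1))
        ≤ ∫⁻ t in Ioi (0 : ℝ), ENNReal.ofReal (K ^ τ * (‖x - y‖ + s) ^ (-(a * τ))) *
            ENNReal.ofReal ((t + s) ^ (-(b * τ)) * t ^ (α * τ - 1)) := by
          refine setLIntegral_mono' measurableSet_Ioi fun t ht => ?_
          have ht0 : 0 < t := ht
          rw [← ENNReal.ofReal_mul (by positivity), ← mul_assoc]
          refine ENNReal.ofReal_le_ofReal (mul_le_mul_of_nonneg_right ?_ (by positivity))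
          refine (rpow_le_rpow (abs_nonneg _) (hf x t ht0) hτ.le).trans_eq ?_
          rw [mul_rpow hK.le (by positivity), mul_rpow (by positivity) (by positivity),
            ← rpow_mul hr.le, ← rpow_mul (by positivity), neg_mul, neg_mul, mul_assoc]
      _ = ENNReal.ofReal (K ^ τ * (‖x - y‖ + s) ^ (-(a * τ))) *
            ∫⁻ t in Ioi (0 : ℝ), ENNReal.ofReal ((t + s) ^ (-(b * τ)) * t ^ (α * τ - 1)) :=
          lintegral_const_mul' _ _ ENNReal.ofReal_ne_top
      _ ≤ ENNReal.ofReal (K ^ τ * (‖x - y‖ + s) ^ (-(a * τ))) *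
            ENNReal.ofReal (d * s ^ (α * τ - b * τ)) := by
          gcongr
          exact lintegral_Ioi_add_rpow_mul_rpow_le (by positivity) (by linarith) hs
      _ = _ := by
          rw [← ENNReal.ofReal_mul (by positivity)]
          congr 1
          ring
  have e1 : (α * τ - b * τ) * (p / τ) = (α - b) * p := by field_simp
  have e2 : -(a * τ) * (p / τ) = -(a * p) := by field_simp
  rw [normF_rpow f hp]
  calc ∫⁻ x : Euc n, (∫⁻ t in Ioi (0 : ℝ),
        ENNReal.ofReal (|f (pt x t)| ^ τ * t ^ (α * τ - 1))) ^ (p / τ)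
      ≤ ∫⁻ x : Euc n, ENNReal.ofReal ((K ^ τ * d) ^ (p / τ) * s ^ ((α - b) * p)) *
          ENNReal.ofReal ((‖x - y‖ + s) ^ (-(a * p))) := by
        refine lintegral_mono fun x => ?_
        have hr : 0 < ‖x - y‖ + s := by positivity
        refine (ENNReal.rpow_le_rpow (hin x) (by positivity)).trans_eq ?_
        rw [ENNReal.ofReal_rpow_of_nonneg (by positivity) (by positivity),
          mul_rpow (by positivity) (by positivity), mul_rpow (by positivity) (by positivity),
          ← rpow_mul hr.le, ← rpow_mul hs.le, e1, e2, ENNReal.ofReal_mul (by positivity)]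
    _ = ENNReal.ofReal ((K ^ τ * d) ^ (p / τ) * s ^ ((α - b) * p)) *
          ∫⁻ x : Euc n, ENNReal.ofReal ((‖x - y‖ + s) ^ (-(a * p))) :=
        lintegral_const_mul' _ _ ENNReal.ofReal_ne_top
    _ ≤ ENNReal.ofReal ((K ^ τ * d) ^ (p / τ) * s ^ ((α - b) * p)) *
          ENNReal.ofReal (c * s ^ ((n : ℝ) - a * p)) := by
        gcongr
        exact h y s hs
    _ = _ := by
        rw [← ENNReal.ofReal_mul (by positivity),
          show (n : ℝ) + α * p - (a + b) * p = (α - b) * p + (n - a * p) by ring, rpow_add hs]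
        congr 1
        ring

theorem exists_isotropic (hn : 0 < n) : ∃ a : Fin (n + 1) → ℂ, ∑ i, a i ^ 2 = 0 ∧
    (∀ z, ‖linForm a z‖ ≤ ‖z‖) ∧ ∀ t, linForm a (pt 0 t) = t := by
  classical
  let o : Fin n := ⟨0, hn⟩
  let a : Fin (n + 1) → ℂ := Fin.snoc (fun i : Fin n => if i = o then Complex.I else 0) 1
  have hL : ∀ z, linForm a z = tp z + Complex.I * (xp z o : ℝ) := fun z => by
    simp [linForm, a, Fin.sum_univ_castSucc, tp, add_comm]
  refine ⟨a, ?_, fun z => ?_, fun t => ?_⟩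
  · simp [a, Fin.sum_univ_castSucc, ite_pow]
  · refine le_of_sq_le_sq ?_ (norm_nonneg _)
    have h : xp z o ^ 2 ≤ ‖xp z‖ ^ 2 := by
      rw [EuclideanSpace.real_norm_sq_eq]
      exact Finset.single_le_sum (f := fun i => xp z i ^ 2) (fun i _ => by positivity)
        (Finset.mem_univ o)
    rw [hL, norm_sq_eq_xp_tp z, ← Complex.normSq_eq_norm_sq, Complex.normSq_apply]
    simp only [Complex.add_re, Complex.ofReal_re, Complex.mul_re, Complex.I_re, Complex.I_im,
      Complex.ofReal_im, Complex.add_im, Complex.mul_im]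
    nlinarith
  · rw [hL]; simp

end KernelBounds

section Necessity

variable {n : ℕ}

theorem pt_smul_add (x y : Euc n) (t u r : ℝ) :
    pt y u + r • pt x t = pt (y + r • x) (u + r * t) := by
  ext i
  refine Fin.lastCases ?_ (fun i => ?_) i <;> simp

theorem norm_sub_pt_neg_ge (x y : Euc n) {t s : ℝ} (ht : 0 < t) (hs : 0 < s) :
    t + s ≤ ‖pt x t - pt y (-s)‖ ∧ (‖x - y‖ + s) / 2 ≤ ‖pt x t - pt y (-s)‖ := by
  have h1 := abs_tp_sub_le (pt x t) (pt y (-s))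
  have h2 := dist_xp_le (pt x t) (pt y (-s))
  rw [tp_pt, tp_pt, dist_eq_norm, sub_neg_eq_add, abs_of_pos (by positivity)] at h1
  rw [xp_pt, xp_pt, dist_eq_norm, dist_eq_norm] at h2
  exact ⟨h1, by linarith⟩

theorem exists_measure_ball_le_of_embedding (hn : 0 < n) {τ p α : ℝ} (hτ : 0 < τ) (hp : 0 < p)
    (hα : 0 < α) {μ : Measure (Euc (n + 1))} {C : ℝ} (hC : 0 < C)
    (h : ∀ f : Euc (n + 1) → ℝ, HarmonicOnE f (upperHS n) → normF n f p τ α < ⊤ →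
      (∫⁻ z in upperHS n, ENNReal.ofReal (|f z| ^ p) ∂μ) ≤
        ENNReal.ofReal C * (normF n f p τ α) ^ p) :
    ∃ ε C' : ℝ, 0 < ε ∧ 0 < C' ∧ ∀ (y : Euc n) (s : ℝ), 0 < s →
      μ (Metric.ball (pt y s) (ε * s)) ≤ ENNReal.ofReal (C' * s ^ ((n : ℝ) + α * p)) := by
  obtain ⟨a, ha, hle, hat⟩ := exists_isotropic hn
  obtain ⟨k, hk⟩ := exists_nat_gt (n / p + (α + 1))
  set β : ℝ := (1 - n) / 2 - k with hβ
  set b : ℝ := α + 1 with hb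
  set m : ℝ := k + n - 1 - b with hm
  have hn1 : (1 : ℝ) ≤ n := by exact_mod_cast hn
  have hmp : n / p < m := by linarith
  have hm0 : 0 < m := lt_of_le_of_lt (by positivity) hmp
  have hM : k + 2 * β = -(m + b) := by rw [hβ, hm]; ring
  set F : Euc (n + 1) → ℝ := kelvin a k β with hF
  obtain ⟨K, hK, hnorm⟩ := exists_normF_rpow_le (n := n) (α := α) (a := m) (b := b) (K := 2 ^ m)
    hτ hp hα (by linarith) (by rwa [div_lt_iff₀ hp] at hmp) (by positivity)
  have hne : pt (0 : Euc n) 2 ≠ 0 := fun h0 => by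
    simpa [tp] using congrArg tp h0
  have hF0 : 0 < F (pt 0 2) := by
    have : 0 < ‖pt (0 : Euc n) 2‖ := norm_pos_iff.2 hne
    rw [hF, kelvin, hat, ← Complex.ofReal_pow, Complex.ofReal_re]
    positivity
  obtain ⟨c, hc, hcF⟩ := exists_between hF0
  obtain ⟨ε, hε, hball⟩ := Metric.eventually_nhds_iff_ball.1
    ((contDiffAt_kelvin a k β hne).continuousAt.eventually_const_lt hcF)
  refine ⟨min ε 1, C * K / c ^ p, by positivity, by positivity, fun y s hs => ?_⟩
  have hf : HarmonicOnE (fun z => F (z - pt y (-s))) (upperHS n) := by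
    refine harmonicOnE_kelvin_sub ha ?_ ?_
    · rw [hβ]; push_cast; ring
    · simp [upperHS, hs.le]
  have hb' : ∀ x t, 0 < t → |F (pt x t - pt y (-s))| ≤
      2 ^ m * ((‖x - y‖ + s) ^ (-m) * (t + s) ^ (-b)) := fun x t ht => by
    obtain ⟨h1, h2⟩ := norm_sub_pt_neg_ge x y ht hs
    have h0 : 0 < ‖pt x t - pt y (-s)‖ := lt_of_lt_of_le (by positivity) h1
    refine (abs_kelvin_le hle k β (norm_pos_iff.1 h0)).trans ?_
    rw [hM, neg_add, rpow_add h0, ← mul_assoc]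
    refine mul_le_mul ?_ (rpow_le_rpow_of_nonpos (by positivity) h1 (by linarith))
      (by positivity) (by positivity)
    refine (rpow_le_rpow_of_nonpos (by positivity) h2 (by linarith)).trans_eq ?_
    rw [div_rpow (by positivity) (by positivity), rpow_neg zero_le_two, div_inv_eq_mul, mul_comm]
  have hN := hnorm (fun z => F (z - pt y (-s))) y s hs hb'
  have hfin : normF n (fun z => F (z - pt y (-s))) p τ α < ⊤ := by
    rw [← ENNReal.rpow_lt_top_iff_of_pos hp]
    exact hN.trans_lt ENNReal.ofReal_lt_top
  have hlow : ∀ z ∈ Metric.ball (pt y s) (min ε 1 * s), z ∈ upperHS n ∧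
      c * s ^ (-(m + b)) ≤ F (z - pt y (-s)) := fun z hz => by
    rw [Metric.mem_ball] at hz
    constructor
    · have := abs_tp_sub_le z (pt y s)
      rw [tp_pt] at this
      have h1 : min ε 1 * s ≤ 1 * s := by gcongr; exact min_le_right _ _
      have := (abs_lt.1 (this.trans_lt (hz.trans_le h1))).1
      show 0 < tp z
      linarith
    · have e : z - pt y (-s) = s • (s⁻¹ • (z - pt y (-s))) := by
        rw [smul_smul, mul_inv_cancel₀ hs.ne', one_smul]
      rw [e, hF, kelvin_smul a k β hs, hM, mul_comm]
      refine mul_le_mul_of_nonneg_left (hball _ ?_).le (by positivity)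
      have e2 : pt y s = pt y (-s) + s • pt 0 2 := by
        rw [pt_smul_add, smul_zero, add_zero, show -s + s * 2 = s by ring]
      have e3 : s⁻¹ • (z - pt y (-s)) - pt 0 2 = s⁻¹ • (z - pt y s) := by
        rw [e2, ← sub_sub, smul_sub s⁻¹ (z - pt y (-s)), smul_smul, inv_mul_cancel₀ hs.ne',
          one_smul]
      rw [Metric.mem_ball, dist_eq_norm, e3, norm_smul, norm_of_nonneg (inv_nonneg.2 hs.le),
        inv_mul_lt_iff₀ hs, ← dist_eq_norm, mul_comm]
      exact hz.trans_le (by gcongr; exact min_le_left _ _)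
  have hkey : ENNReal.ofReal ((c * s ^ (-(m + b))) ^ p) * μ (Metric.ball (pt y s) (min ε 1 * s)) ≤
      ENNReal.ofReal C * ENNReal.ofReal (K * s ^ ((n : ℝ) + α * p - (m + b) * p)) := by
    calc _ = ∫⁻ z in Metric.ball (pt y s) (min ε 1 * s),
          ENNReal.ofReal ((c * s ^ (-(m + b))) ^ p) ∂μ := (setLIntegral_const _ _).symm
      _ ≤ ∫⁻ z in Metric.ball (pt y s) (min ε 1 * s),
          ENNReal.ofReal (|F (z - pt y (-s))| ^ p) ∂μ := by
        refine setLIntegral_mono' measurableSet_ball fun z hz => ?_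
        refine ENNReal.ofReal_le_ofReal (rpow_le_rpow (by positivity) ?_ hp.le)
        exact (hlow z hz).2.trans (le_abs_self _)
      _ ≤ ∫⁻ z in upperHS n, ENNReal.ofReal (|F (z - pt y (-s))| ^ p) ∂μ :=
        lintegral_mono_set fun z hz => (hlow z hz).1
      _ ≤ _ := h _ hf hfin
      _ ≤ _ := by gcongr
  have hpos : 0 < (c * s ^ (-(m + b))) ^ p := by positivity
  rw [mul_comm, ← ENNReal.le_div_iff_mul_le (Or.inl (by simpa using hpos))
    (Or.inl ENNReal.ofReal_ne_top), ← ENNReal.ofReal_mul hC.le, ← ENNReal.ofReal_div_of_pos hpos]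
    at hkey
  refine hkey.trans_eq ?_
  congr 1
  rw [mul_rpow hc.le (by positivity), ← rpow_mul hs.le, sub_eq_add_neg, rpow_add hs, neg_mul]
  have := (rpow_pos_of_pos hs (-((m + b) * p))).ne'
  field_simp

theorem exists_carleson_of_measure_ball_le {γ ε C : ℝ} (hε : 0 < ε) (hC : 0 < C) (hγ : 0 ≤ γ)
    {μ : Measure (Euc (n + 1))}
    (h : ∀ (y : Euc n) (s : ℝ), 0 < s →
      μ (Metric.ball (pt y s) (ε * s)) ≤ ENNReal.ofReal (C * s ^ γ)) :
    ∃ C' : ℝ, 0 < C' ∧ ∀ (y : Euc n) (r : ℝ), 0 < r →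
      μ (Qcube y r) ≤ ENNReal.ofReal (C' * r ^ γ) := by
  have hcpt : IsCompact (Qcube (0 : Euc n) 1) := by
    refine Metric.isCompact_of_isClosed_isBounded ?_ ?_
    · have : Qcube (0 : Euc n) 1 =
          (⋂ i : Fin n, {z | |z (Fin.castSucc i) - (0 : Euc n) i| ≤ 1 / 2}) ∩
          {z | |tp z - 1| ≤ 1 / 2} := by
        ext z; simp [Qcube]
      rw [this]
      refine (isClosed_iInter fun i => isClosed_le ?_ continuous_const).inter
        (isClosed_le (continuous_tp.sub continuous_const).abs continuous_const)
      fun_prop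
    · refine isBounded_iff_forall_norm_le.2 ⟨√(n + 9 / 4), fun z hz => ?_⟩
      refine Real.le_sqrt_of_sq_le ?_
      rw [EuclideanSpace.norm_sq_eq, Fin.sum_univ_castSucc]
      refine add_le_add ?_ ?_
      · refine (Finset.sum_le_card_nsmul _ _ 1 fun i _ => ?_).trans_eq (by simp)
        have := hz.1 i
        rw [PiLp.zero_apply, sub_zero] at this
        rw [norm_eq_abs]
        nlinarith [abs_nonneg (z (Fin.castSucc i))]
      · have := abs_le.1 hz.2
        rw [norm_eq_abs, sq_abs]
        change tp z ^ 2 ≤ _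
        nlinarith
  obtain ⟨T, hT, hfin, hcov⟩ := hcpt.finite_cover_balls (show 0 < ε / 2 by positivity)
  refine ⟨hfin.toFinset.card * (C * (3 / 2) ^ γ) + 1, by positivity, fun y r hr => ?_⟩
  have hsub : Qcube y r ⊆ ⋃ w ∈ hfin.toFinset,
      Metric.ball (pt (y + r • xp w) (r * tp w)) (ε * (r * tp w)) := by
    intro z hz
    have hz' : r⁻¹ • (z - pt y 0) ∈ Qcube (0 : Euc n) 1 := by
      constructor
      · intro i
        have := hz.1 i
        simp only [PiLp.smul_apply, PiLp.sub_apply, pt_castSucc, PiLp.zero_apply, sub_zero,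
          smul_eq_mul, abs_mul, abs_of_pos (inv_pos.2 hr)]
        rw [inv_mul_le_iff₀ hr]
        linarith
      · have := hz.2
        have e : tp (r⁻¹ • (z - pt y 0)) - 1 = r⁻¹ * (tp z - r) := by
          simp [tp, mul_sub, hr.ne']
        rw [e, abs_mul, abs_of_pos (inv_pos.2 hr), inv_mul_le_iff₀ hr]
        linarith
    obtain ⟨w, hw, hzw⟩ := mem_iUnion₂.1 (hcov hz')
    refine mem_iUnion₂.2 ⟨w, by simpa using hw, ?_⟩
    have htw := abs_le.1 (hT hw).2
    have e0 : w = pt (xp w) (tp w) := by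
      ext i
      refine Fin.lastCases ?_ (fun i => ?_) i <;> simp [tp]
    have e : z - pt (y + r • xp w) (r * tp w) = r • (r⁻¹ • (z - pt y 0) - w) := by
      rw [smul_sub, smul_smul, mul_inv_cancel₀ hr.ne', one_smul, sub_sub, e0, pt_smul_add, ← e0,
        zero_add]
    rw [Metric.mem_ball, dist_eq_norm] at hzw ⊢
    rw [e, norm_smul, norm_of_nonneg hr.le]
    calc r * ‖r⁻¹ • (z - pt y 0) - w‖ < r * (ε / 2) := by gcongr
      _ ≤ ε * (r * tp w) := by
        have : 0 ≤ ε * r * (tp w - 1 / 2) := mul_nonneg (by positivity) (by linarith)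
        linarith
  calc μ (Qcube y r) ≤ ∑ w ∈ hfin.toFinset,
        μ (Metric.ball (pt (y + r • xp w) (r * tp w)) (ε * (r * tp w))) :=
        (measure_mono hsub).trans (measure_biUnion_finset_le _ _)
    _ ≤ ∑ w ∈ hfin.toFinset, ENNReal.ofReal (C * (3 / 2) ^ γ * r ^ γ) := by
        refine Finset.sum_le_sum fun w hw => ?_
        have htw := abs_le.1 (hT (by simpa using hw)).2
        have ht0 : 0 < tp w := by linarith
        refine (h _ _ (mul_pos hr ht0)).trans (ENNReal.ofReal_le_ofReal ?_)
        rw [mul_assoc, ← mul_rpow (by norm_num) hr.le, mul_comm (3 / 2) r]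
        gcongr
        linarith
    _ = ENNReal.ofReal (hfin.toFinset.card * (C * (3 / 2) ^ γ) * r ^ γ) := by
        rw [Finset.sum_const, nsmul_eq_mul, mul_assoc (_ : ℝ) (C * _),
          ENNReal.ofReal_mul (p := (hfin.toFinset.card : ℝ)) (by positivity),
          ENNReal.ofReal_natCast]
    _ ≤ _ := by
        refine ENNReal.ofReal_le_ofReal ?_
        gcongr
        linarith

end Necessity

/-- Carleson measures for the harmonic Triebel–Lizorkin space F^{p,τ}_α. -/
theorem stmt4 (n : ℕ) (hn : 2 ≤ n) (τ p α : ℝ) (hτ : 0 < τ) (hτp : τ ≤ p)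
    (hα : 0 < α) (μ : Measure (Euc (n + 1))) :
    (∃ C : ℝ, 0 < C ∧ ∀ (y : Euc n) (r : ℝ), 0 < r →
        μ (Qcube y r) ≤ ENNReal.ofReal (C * r ^ ((n : ℝ) + α * p))) ↔
    (∃ C' : ℝ, 0 < C' ∧ ∀ f : Euc (n + 1) → ℝ,
        HarmonicOnE f (upperHS n) → normF n f p τ α < ⊤ →
        (∫⁻ z in upperHS n, ENNReal.ofReal (|f z| ^ p) ∂μ) ≤
          ENNReal.ofReal C' * (normF n f p τ α) ^ p) := by
  have hp : 0 < p := hτ.trans_le hτp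
  constructor
  · rintro ⟨C, hC, h⟩
    obtain ⟨C', hC', h'⟩ := exists_embedding_of_carleson hτ hτp hC h
    exact ⟨C', hC', fun f hf _ => h' f hf⟩
  · rintro ⟨C, hC, h⟩
    obtain ⟨ε, C', hε, hC', h'⟩ :=
      exists_measure_ball_le_of_embedding (by omega) hτ hp hα hC h
    exact exists_carleson_of_measure_ball_le hε hC' (by positivity) h'

end
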